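/- arXiv:1110.2630 — 9 statements merged into one kernel-verified Lean document; each statement's English description precedes it below -/
import Mathlib

section
/- Let N ≥ 1, let μ_1,…,μ_l ∈ ℂ be pairwise distinct and nonzero, and let n_1,…,n_l be positive integers with n_1 + … + n_l = N. Let o = diag(μ_1·I_{n_1},…,μ_l·I_{n_l}) and O = {g·o·g⁻¹ : g ∈ GL_N(ℂ)}. Consider the polynomial map Ψ : Mat_N(ℂ) → Mat_N(ℂ) × ℂ^N, Ψ(A) = ((A − μ_1)⋯(A − μ_l), (Tr A, Tr A²,…, Tr A^N)). Then for every B ∈ O, the kernel of the derivative (differential) dΨ_B of Ψ at B equals the tangent space {XB − BX : X ∈ Mat_N(ℂ)} of O at B, which has dimension N² − (n_1² + … + n_l²); equivalently, the rank of dΨ_B equals n_1² + … + n_l² = N² − dim O at every point B of O. -/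
/-- The index set of `ℂ^N` partitioned into blocks of sizes `n 0, …, n (l-1)`
(so that `N = ∑ j, n j`). -/
abbrev BlockIdx (l : ℕ) (n : Fin l → ℕ) : Type := Σ j : Fin l, Fin (n j)

namespace GLJac
open Matrix

variable {ι : Type} [Fintype ι] [DecidableEq ι]

def MD (F : ℂ → Matrix ι ι ℂ) (F' : Matrix ι ι ℂ) : Prop :=
  ∀ i j, HasDerivAt (fun t => F t i j) (F' i j) 0

lemma MD.mul {F G : ℂ → Matrix ι ι ℂ} {F' G' : Matrix ι ι ℂ} (hF : MD F F') (hG : MD G G') :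
    MD (fun t => F t * G t) (F' * G 0 + F 0 * G') := by
  intro i j
  have h := HasDerivAt.fun_sum (u := Finset.univ) (fun k _ => (hF i k).mul (hG k j))
  simp only [Matrix.add_apply, Matrix.mul_apply]
  rw [← Finset.sum_add_distrib]
  exact h

lemma MD.const (C : Matrix ι ι ℂ) : MD (fun _ => C) 0 := fun i j => by
  simpa using hasDerivAt_const (0:ℂ) (C i j)

def phi : List ℂ → ℂ → ℂ → ℂ
  | [], _, _ => 0
  | c :: L, x, y => (L.map (fun b => y - b)).prod + (x - c) * phi L x y

lemma phi_sub (L : List ℂ) (x y : ℂ) :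
    (x - y) * phi L x y = (L.map (fun b => x - b)).prod - (L.map (fun b => y - b)).prod := by
  induction L with
  | nil => simp [phi]
  | cons c L ih =>
    simp only [phi, List.map_cons, List.prod_cons]
    linear_combination (x - c) * ih

lemma prod_eq_zero_of_mem {L : List ℂ} {x : ℂ} (h : x ∈ L) :
    (L.map (fun b => x - b)).prod = 0 := by
  rw [List.prod_eq_zero_iff, List.mem_map]
  exact ⟨x, h, sub_self x⟩

lemma phi_ne {L : List ℂ} (hL : L.Nodup) {x : ℂ} (hx : x ∈ L) : phi L x x ≠ 0 := by
  induction L with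
  | nil => simp at hx
  | cons c L ih =>
    rw [List.nodup_cons] at hL
    by_cases hc : x = c
    · subst hc
      simp only [phi, sub_self, zero_mul, add_zero, ne_eq, List.prod_eq_zero_iff, List.mem_map,
        not_exists, not_and]
      intro b hb h
      exact hL.1 (by rw [sub_eq_zero.1 h]; exact hb)
    · have hx' : x ∈ L := by simpa [hc] using hx
      simp only [phi, prod_eq_zero_of_mem hx', zero_add]
      exact mul_ne_zero (sub_ne_zero.2 hc) (ih hL.2 hx')

lemma phi_off {L : List ℂ} {x y : ℂ} (hx : x ∈ L) (hy : y ∈ L) (h : x ≠ y) : phi L x y = 0 := by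
  have := phi_sub L x y
  rw [prod_eq_zero_of_mem hx, prod_eq_zero_of_mem hy, sub_zero] at this
  exact (mul_eq_zero.1 this).resolve_left (sub_ne_zero.2 h)

def P (B ξ : Matrix ι ι ℂ) (L : List ℂ) (t : ℂ) : Matrix ι ι ℂ :=
  (L.map (fun c => B + t • ξ - c • (1 : Matrix ι ι ℂ))).prod

lemma diag_sub (d : ι → ℂ) (c : ℂ) :
    diagonal d - c • (1 : Matrix ι ι ℂ) = diagonal (fun i => d i - c) := by
  rw [← diagonal_one, ← diagonal_smul, diagonal_sub]
  simp

lemma P_zero (d : ι → ℂ) (ζ : Matrix ι ι ℂ) (L : List ℂ) :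
    P (diagonal d) ζ L 0 = diagonal (fun i => (L.map (fun b => d i - b)).prod) := by
  induction L with
  | nil => simp [P]
  | cons c L ih =>
    have : P (diagonal d) ζ (c :: L) 0
      = (diagonal d - c • (1 : Matrix ι ι ℂ)) * P (diagonal d) ζ L 0 := by simp [P]
    rw [this, ih, diag_sub, diagonal_mul_diagonal]
    simp

lemma MD_P (d : ι → ℂ) (ζ : Matrix ι ι ℂ) (L : List ℂ) :
    MD (P (diagonal d) ζ L) (Matrix.of fun i j => ζ i j * phi L (d i) (d j)) := by
  induction L with
  | nil =>
    have h := MD.const (1 : Matrix ι ι ℂ)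
    intro i j
    simpa [phi, P] using h i j
  | cons c L ih =>
    have h1 : MD (fun t : ℂ => diagonal d + t • ζ - c • (1 : Matrix ι ι ℂ)) ζ := by
      intro i j
      have := (((hasDerivAt_id (0:ℂ)).mul_const (ζ i j)).const_add (diagonal d i j)).sub_const
        ((c • (1 : Matrix ι ι ℂ)) i j)
      simpa using this
    have h := h1.mul ih
    have e : (ζ * P (diagonal d) ζ L 0 + (diagonal d + (0:ℂ) • ζ - c • (1 : Matrix ι ι ℂ)) *
        (Matrix.of fun i j => ζ i j * phi L (d i) (d j)))
        = Matrix.of fun i j => ζ i j * phi (c :: L) (d i) (d j) := by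
      rw [P_zero, zero_smul, add_zero, diag_sub]
      ext i j
      rw [Matrix.add_apply, mul_diagonal, diagonal_mul]
      simp only [of_apply, phi]
      ring
    rw [← e]
    intro i j
    simpa [P] using h i j

lemma conj_P (g : (Matrix ι ι ℂ)ˣ) (D ζ : Matrix ι ι ℂ) (L : List ℂ) (t : ℂ) :
    P (g.val * D * (g⁻¹).val) (g.val * ζ * (g⁻¹).val) L t = g.val * P D ζ L t * (g⁻¹).val := by
  induction L with
  | nil => simp [P]
  | cons c L ih =>
    have e : ∀ B ξ : Matrix ι ι ℂ, P B ξ (c :: L) t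
      = (B + t • ξ - c • (1 : Matrix ι ι ℂ)) * P B ξ L t := by intros; simp [P]
    rw [e, e, ih]
    have : g.val * D * (g⁻¹).val + t • (g.val * ζ * (g⁻¹).val) - c • (1 : Matrix ι ι ℂ)
        = g.val * (D + t • ζ - c • (1 : Matrix ι ι ℂ)) * (g⁻¹).val := by
      simp [mul_add, add_mul, mul_sub, sub_mul]
    rw [this]
    simp only [mul_assoc, Units.inv_mul_cancel_left]

lemma MD_conj (g : (Matrix ι ι ℂ)ˣ) (d : ι → ℂ) (ζ : Matrix ι ι ℂ) (L : List ℂ) :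
    MD (P (g.val * diagonal d * (g⁻¹).val) (g.val * ζ * (g⁻¹).val) L)
      (g.val * (Matrix.of fun i j => ζ i j * phi L (d i) (d j)) * (g⁻¹).val) := by
  have h := ((MD.const g.val).mul (MD_P d ζ L)).mul (MD.const (g⁻¹).val)
  intro i j
  have := h i j
  simp only [zero_mul, zero_add, mul_zero, add_zero] at this
  simpa only [conj_P] using this

lemma conj_eq_zero (g : (Matrix ι ι ℂ)ˣ) (M : Matrix ι ι ℂ) :
    g.val * M * (g⁻¹).val = 0 ↔ M = 0 := by
  rw [Units.mul_left_eq_zero, Units.mul_right_eq_zero]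

lemma P_pow (B ξ : Matrix ι ι ℂ) (m : ℕ) (t : ℂ) :
    P B ξ (List.replicate m 0) t = (B + t • ξ) ^ m := by
  simp [P]

/-- first order condition for block matrices -/
lemma exists_comm_iff {κ : Type} (b : ι → κ) (μ : κ → ℂ) (hμ : Function.Injective μ)
    (ζ : Matrix ι ι ℂ) :
    (∃ X : Matrix ι ι ℂ, ζ = X * diagonal (fun i => μ (b i)) - diagonal (fun i => μ (b i)) * X) ↔
      ∀ i j, b i = b j → ζ i j = 0 := by
  constructor
  · rintro ⟨X, rfl⟩ i j h
    rw [Matrix.sub_apply, mul_diagonal, diagonal_mul, h]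
    ring
  · intro h
    refine ⟨Matrix.of fun i j => ζ i j / (μ (b j) - μ (b i)), ?_⟩
    ext i j
    rw [Matrix.sub_apply, mul_diagonal, diagonal_mul]
    by_cases hb : b i = b j
    · simp [h i j hb]
    · have : μ (b j) - μ (b i) ≠ 0 := sub_ne_zero.2 fun h => hb (hμ h).symm
      simp only [of_apply]
      field_simp

lemma conj_comm_iff (g : (Matrix ι ι ℂ)ˣ) (D ζ : Matrix ι ι ℂ) :
    (∃ X : Matrix ι ι ℂ, g.val * ζ * (g⁻¹).val
        = X * (g.val * D * (g⁻¹).val) - (g.val * D * (g⁻¹).val) * X) ↔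
      ∃ X : Matrix ι ι ℂ, ζ = X * D - D * X := by
  constructor
  · rintro ⟨X, h⟩
    refine ⟨(g⁻¹).val * X * g.val, ?_⟩
    have : ζ = (g⁻¹).val * (g.val * ζ * (g⁻¹).val) * g.val := by simp [mul_assoc]
    rw [this, h]
    simp [mul_sub, sub_mul, mul_assoc]
  · rintro ⟨X, rfl⟩
    refine ⟨g.val * X * (g⁻¹).val, ?_⟩
    simp [mul_sub, sub_mul, mul_assoc]

def blk {κ : Type} (b : ι → κ) : Submodule ℂ (Matrix ι ι ℂ) where
  carrier := {ζ | ∀ i j, b i = b j → ζ i j = 0}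
  add_mem' := by
    intro x y hx hy i j h
    simp [hx i j h, hy i j h]
  zero_mem' := by intro i j _; rfl
  smul_mem' := by
    intro c x hx i j h
    simp [hx i j h]

open Classical in
noncomputable def blkEquiv {κ : Type} (b : ι → κ) :
    blk b ≃ₗ[ℂ] ({p : ι × ι // ¬ b p.1 = b p.2} → ℂ) where
  toFun ζ p := ζ.1 p.1.1 p.1.2
  map_add' _ _ := rfl
  map_smul' _ _ := rfl
  invFun f := ⟨Matrix.of fun i j => if h : b i = b j then 0 else f ⟨(i, j), h⟩, by
    intro i j h
    simp [h]⟩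
  left_inv ζ := by
    ext i j
    by_cases h : b i = b j
    · simp [h, ζ.2 i j h]
    · simp [h]
  right_inv f := by
    ext ⟨⟨i, j⟩, h⟩
    simp at h
    simp [h]

def conjEquiv (g : (Matrix ι ι ℂ)ˣ) : Matrix ι ι ℂ ≃ₗ[ℂ] Matrix ι ι ℂ where
  toFun ζ := g.val * ζ * (g⁻¹).val
  map_add' x y := by simp [mul_add, add_mul]
  map_smul' c x := by simp
  invFun ζ := (g⁻¹).val * ζ * g.val
  left_inv x := by simp [mul_assoc]
  right_inv x := by simp [mul_assoc]

def pairEquiv (l : ℕ) (n : Fin l → ℕ) :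
    {p : BlockIdx l n × BlockIdx l n // p.1.1 = p.2.1} ≃ Σ j : Fin l, Fin (n j) × Fin (n j) where
  toFun p := ⟨p.1.1.1, p.1.1.2, p.2 ▸ p.1.2.2⟩
  invFun q := ⟨(⟨q.1, q.2.1⟩, ⟨q.1, q.2.2⟩), rfl⟩
  left_inv := by
    rintro ⟨⟨⟨i, a⟩, ⟨j, c⟩⟩, h⟩
    dsimp at h
    subst h
    rfl
  right_inv := by
    rintro ⟨j, a, c⟩
    rfl

lemma card_off (l : ℕ) (n : Fin l → ℕ) :
    Fintype.card {p : BlockIdx l n × BlockIdx l n // ¬ p.1.1 = p.2.1}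
      = (∑ j, n j) ^ 2 - ∑ j, (n j) ^ 2 := by
  rw [Fintype.card_subtype_compl, Fintype.card_congr (pairEquiv l n)]
  simp [pow_two]

end GLJac


/-- at every point `B` of the conjugacy class of
`o = diag(μ_1·I_{n_1},…,μ_l·I_{n_l})`, the kernel of the differential of
`Ψ(A) = ((A−μ_1)⋯(A−μ_l), (Tr A, …, Tr A^N))` equals the tangent space
`{XB − BX}`, which has dimension `N² − Σ n_i²`. -/
theorem gl_class_jacobian_kernel
    (N : ℕ) (hN : 1 ≤ N) (l : ℕ) (n : Fin l → ℕ) (hn : ∀ j, 0 < n j)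
    (hsum : ∑ j, n j = N)
    (μ : Fin l → ℂ) (hμ0 : ∀ j, μ j ≠ 0) (hμ : Function.Injective μ) :
    let o : Matrix (BlockIdx l n) (BlockIdx l n) ℂ := Matrix.diagonal fun x => μ x.1
    let O : Set (Matrix (BlockIdx l n) (BlockIdx l n) ℂ) :=
      {B | ∃ g : (Matrix (BlockIdx l n) (BlockIdx l n) ℂ)ˣ,
        B = (g : Matrix (BlockIdx l n) (BlockIdx l n) ℂ) * o *
          ((g⁻¹ : (Matrix (BlockIdx l n) (BlockIdx l n) ℂ)ˣ) :
            Matrix (BlockIdx l n) (BlockIdx l n) ℂ)}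
    ∀ B ∈ O,
      ({ξ : Matrix (BlockIdx l n) (BlockIdx l n) ℂ |
          (∀ i j : BlockIdx l n,
            deriv (fun t : ℂ =>
              ((List.ofFn fun a : Fin l =>
                B + t • ξ - μ a • (1 : Matrix (BlockIdx l n) (BlockIdx l n) ℂ)).prod :
                Matrix (BlockIdx l n) (BlockIdx l n) ℂ) i j) 0 = 0) ∧
          (∀ m ∈ Finset.Icc 1 N,
            deriv (fun t : ℂ => Matrix.trace ((B + t • ξ) ^ m)) 0 = 0)}
        = {η : Matrix (BlockIdx l n) (BlockIdx l n) ℂ |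
            ∃ X : Matrix (BlockIdx l n) (BlockIdx l n) ℂ, η = X * B - B * X}) ∧
      Module.finrank ℂ
          ↥(LinearMap.range (LinearMap.mulRight ℂ B - LinearMap.mulLeft ℂ B))
        = N ^ 2 - ∑ j, (n j) ^ 2 := by
  intro o O B hB
  obtain ⟨g, rfl⟩ := hB
  have key : ∀ ζ : Matrix (BlockIdx l n) (BlockIdx l n) ℂ,
      (∃ X, (g.val * ζ * (g⁻¹).val) = X * (g.val * o * (g⁻¹).val) - (g.val * o * (g⁻¹).val) * X) ↔
        ∀ i j : BlockIdx l n, i.1 = j.1 → ζ i j = 0 := fun ζ => by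
    rw [GLJac.conj_comm_iff]
    exact GLJac.exists_comm_iff (fun x : BlockIdx l n => x.1) μ hμ ζ
  constructor
  · ext ξ
    obtain ⟨ζ, rfl⟩ := (GLJac.conjEquiv g).surjective ξ
    change _ ↔ ∃ X, (g.val * ζ * (g⁻¹).val) = _
    rw [key]
    have hmem : ∀ k, μ k ∈ List.ofFn μ := fun k => by simp [List.mem_ofFn]
    have hnd : (List.ofFn μ).Nodup := List.nodup_ofFn.2 hμ
    have hP : ∀ t : ℂ, (List.ofFn fun a : Fin l =>
          g.val * o * (g⁻¹).val + t • (g.val * ζ * (g⁻¹).val)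
            - μ a • (1 : Matrix (BlockIdx l n) (BlockIdx l n) ℂ)).prod
        = GLJac.P (g.val * o * (g⁻¹).val) (g.val * ζ * (g⁻¹).val) (List.ofFn μ) t := by
      intro t
      rw [GLJac.P, List.map_ofFn]
      rfl
    have hd := GLJac.MD_conj g (fun x : BlockIdx l n => μ x.1) ζ (List.ofFn μ)
    constructor
    · rintro ⟨h, -⟩ i j hij
      have h0 : g.val * (Matrix.of fun i j : BlockIdx l n =>
          ζ i j * GLJac.phi (List.ofFn μ) (μ i.1) (μ j.1)) * (g⁻¹).val = 0 := by
        ext a b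
        rw [← (hd a b).deriv]
        refine Eq.trans ?_ (h a b)
        congr 1
        funext t
        exact congrFun (congrFun (hP t).symm a) b
      rw [GLJac.conj_eq_zero] at h0
      have h1 := congrFun (congrFun h0 i) j
      simp only [Matrix.of_apply, Matrix.zero_apply, hij] at h1
      exact (mul_eq_zero.1 h1).resolve_right (GLJac.phi_ne hnd (hmem _))
    · intro h
      constructor
      · intro a b
        have h0 : (Matrix.of fun i j : BlockIdx l n =>
          ζ i j * GLJac.phi (List.ofFn μ) (μ i.1) (μ j.1)) = 0 := by
          ext i j
          by_cases hij : i.1 = j.1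
          · simp [h i j hij]
          · simp [GLJac.phi_off (hmem i.1) (hmem j.1) (fun e => hij (hμ e))]
        have h1 := (hd a b).deriv
        rw [h0] at h1
        simp only [mul_zero, zero_mul, Matrix.zero_apply] at h1
        refine Eq.trans ?_ h1
        congr 1
        funext t
        exact congrFun (congrFun (hP t) a) b
      · intro m _
        have hm := GLJac.MD_conj g (fun x : BlockIdx l n => μ x.1) ζ (List.replicate m 0)
        have hs := HasDerivAt.fun_sum (u := Finset.univ) (fun k _ => hm k k)
        have h1 := hs.deriv
        have h2 : ∑ k, (g.val * (Matrix.of fun i j : BlockIdx l n =>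
            ζ i j * GLJac.phi (List.replicate m 0) (μ i.1) (μ j.1)) * (g⁻¹).val) k k = 0 := by
          change Matrix.trace _ = 0
          rw [Matrix.trace_mul_comm, ← mul_assoc, Units.inv_mul, one_mul, Matrix.trace]
          refine Finset.sum_eq_zero fun i _ => ?_
          simp [h i i rfl]
        rw [h2] at h1
        refine Eq.trans ?_ h1
        congr 1
        funext t
        simp only [GLJac.P_pow]
        rfl
  · have hr : LinearMap.range (LinearMap.mulRight ℂ (g.val * o * (g⁻¹).val)
        - LinearMap.mulLeft ℂ (g.val * o * (g⁻¹).val))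
        = (GLJac.blk (fun x : BlockIdx l n => x.1)).map (GLJac.conjEquiv g).toLinearMap := by
      ext ξ
      obtain ⟨ζ, rfl⟩ := (GLJac.conjEquiv g).surjective ξ
      have h1 : (GLJac.conjEquiv g ζ ∈
          (GLJac.blk (fun x : BlockIdx l n => x.1)).map (GLJac.conjEquiv g).toLinearMap) ↔
          ζ ∈ GLJac.blk (fun x : BlockIdx l n => x.1) := by
        simp [Submodule.mem_map]
      rw [h1]
      refine Iff.trans ?_ (key ζ)
      constructor
      · rintro ⟨X, hX⟩
        exact ⟨X, hX.symm⟩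
      · rintro ⟨X, hX⟩
        exact ⟨X, hX.symm⟩
    rw [hr, LinearEquiv.finrank_map_eq, (GLJac.blkEquiv _).finrank_eq,
      Module.finrank_fintype_fun_eq_card, ← hsum, ← GLJac.card_off]
end

section
/- Let μ_1,…,μ_l ∈ ℂ be pairwise distinct, let n_1,…,n_l be positive integers with n_1 + … + n_l = N, and let o = diag(μ_1·I_{n_1},…,μ_l·I_{n_l}) ∈ Mat_N(ℂ). Let F(A) = (A − μ_1)⋯(A − μ_l) and let dF_o denote its derivative at o. Then for every ξ ∈ Mat_N(ℂ) with dF_o(ξ) = 0 and every k ≥ 1, the derivative at o of the trace function A ↦ Tr(A^k) in direction ξ also vanishes, i.e. Tr(o^{k−1} ξ) = 0. (In other words, ker dF_o ⊆ ker dϑ_k for ϑ_k(A) = Tr(A^k).) -/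
open Polynomial in
lemma entry_deriv_list {ι : Type*} [Fintype ι] [DecidableEq ι] (d : ι → ℂ) (ξ : Matrix ι ι ℂ)
    (L : List ℂ) :
    ((L.map fun c => Matrix.diagonal d + (0 : ℂ) • ξ - c • (1 : Matrix ι ι ℂ)).prod
      = Matrix.diagonal fun i => ((L.map fun c => (X - C c : ℂ[X])).prod).eval (d i)) ∧
    ∃ D : Matrix ι ι ℂ,
      (∀ i j, HasDerivAt (fun t : ℂ =>
        ((L.map fun c => Matrix.diagonal d + t • ξ - c • (1 : Matrix ι ι ℂ)).prod) i j)
          (D i j) 0) ∧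
      ∀ i, D i i = ξ i i * (derivative ((L.map fun c => (X - C c : ℂ[X])).prod)).eval (d i) := by
  induction L with
  | nil =>
    refine ⟨by simp, 0, fun i j => ?_, fun i => by simp⟩
    simpa using hasDerivAt_const (0 : ℂ) ((1 : Matrix ι ι ℂ) i j)
  | cons c L ih =>
    obtain ⟨h0, D, hD, hDi⟩ := ih
    have hfac : Matrix.diagonal d + (0 : ℂ) • ξ - c • (1 : Matrix ι ι ℂ)
        = Matrix.diagonal fun i => d i - c := by
      ext i j
      by_cases h : i = j <;> simp [Matrix.diagonal_apply, Matrix.one_apply, h]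
    refine ⟨?_, ξ * (Matrix.diagonal fun i =>
        ((L.map fun c => (X - C c : ℂ[X])).prod).eval (d i))
        + (Matrix.diagonal fun i => d i - c) * D, fun i j => ?_, fun i => ?_⟩
    · rw [List.map_cons, List.prod_cons, h0, hfac, Matrix.diagonal_mul_diagonal]
      simp
    · simp only [List.map_cons, List.prod_cons]
      have h1 : ∀ k, HasDerivAt (fun t : ℂ =>
          (Matrix.diagonal d + t • ξ - c • (1 : Matrix ι ι ℂ)) i k) (ξ i k) 0 := by
        intro k
        have := (((hasDerivAt_id (0 : ℂ)).mul_const (ξ i k)).const_add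
          (Matrix.diagonal d i k)).sub_const ((c • (1 : Matrix ι ι ℂ)) i k)
        simpa using this
      have h2 := HasDerivAt.fun_sum (u := Finset.univ) fun k _ => (h1 k).fun_mul (hD k j)
      simp only [Matrix.mul_apply]
      refine h2.congr_deriv ?_
      rw [Finset.sum_add_distrib, h0, hfac]
      rfl
    · rw [Matrix.add_apply, Matrix.mul_diagonal, Matrix.diagonal_mul, hDi]
      simp
      ring

/-- at `o = diag(μ_1·I_{n_1},…,μ_l·I_{n_l})`, every direction `ξ` in the
kernel of the differential of `F(A) = (A−μ_1)⋯(A−μ_l)` also annihilates the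
differential of every trace function `A ↦ Tr(A^k)`, i.e. `Tr(o^{k−1} ξ) = 0`. -/
theorem trace_differentials_redundant
    (N : ℕ) (l : ℕ) (n : Fin l → ℕ) (hn : ∀ j, 0 < n j) (hsum : ∑ j, n j = N)
    (μ : Fin l → ℂ) (hμ : Function.Injective μ) :
    let o : Matrix (BlockIdx l n) (BlockIdx l n) ℂ := Matrix.diagonal fun x => μ x.1
    ∀ ξ : Matrix (BlockIdx l n) (BlockIdx l n) ℂ,
      (∀ i j : BlockIdx l n,
        deriv (fun t : ℂ =>
          ((List.ofFn fun a : Fin l =>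
            o + t • ξ - μ a • (1 : Matrix (BlockIdx l n) (BlockIdx l n) ℂ)).prod :
            Matrix (BlockIdx l n) (BlockIdx l n) ℂ) i j) 0 = 0) →
      ∀ m : ℕ, 1 ≤ m →
        Matrix.trace (o ^ (m - 1) * ξ) = 0 ∧
        deriv (fun t : ℂ => Matrix.trace ((o + t • ξ) ^ m)) 0 = 0 := by
  intro o ξ h m hm
  have hz : ∀ i, ξ i i = 0 := by
    intro i
    obtain ⟨-, D, hD, hDi⟩ := entry_deriv_list (fun x : BlockIdx l n => μ x.1) ξ (List.ofFn μ)
    have h1 := h i i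
    have h2 := (hD i i).deriv
    simp only [List.map_ofFn] at h2
    have h3 : D i i = 0 := by
      rw [← h2]; exact h1
    rw [hDi] at h3
    refine (mul_eq_zero.1 h3).resolve_right ?_
    rw [List.map_ofFn, List.prod_ofFn]
    have hs : (∏ a, (Polynomial.X - Polynomial.C (μ a))).Separable :=
      Polynomial.separable_prod_X_sub_C_iff.2 hμ
    have := hs.eval₂_derivative_ne_zero (RingHom.id ℂ) (x := μ i.1) (by
      rw [Polynomial.eval₂_id, Polynomial.eval_prod]
      exact Finset.prod_eq_zero (Finset.mem_univ i.1) (by simp))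
    rwa [Polynomial.eval₂_id] at this
  constructor
  · simp only [o, Matrix.diagonal_pow, Matrix.trace, Matrix.diag, Matrix.diagonal_mul, hz,
      mul_zero, Finset.sum_const_zero]
  · obtain ⟨-, D, hD, hDi⟩ :=
      entry_deriv_list (fun x : BlockIdx l n => μ x.1) ξ (List.replicate m 0)
    have h2 := HasDerivAt.fun_sum (u := Finset.univ) fun k _ => hD k k
    simp only [hDi, hz, zero_mul, Finset.sum_const_zero, List.map_replicate, zero_smul, sub_zero,
      List.prod_replicate] at h2
    exact h2.deriv
end

section
/- Let N ≥ 1, let μ_1,…,μ_l ∈ ℂ be pairwise distinct and nonzero, and let n_1,…,n_l be positive integers with n_1 + … + n_l = N. Let o = diag(μ_1·I_{n_1},…,μ_l·I_{n_l}) ∈ Mat_N(ℂ). Then for a matrix B ∈ Mat_N(ℂ) the following are equivalent: (i) (B − μ_1)(B − μ_2)⋯(B − μ_l) = 0 and Tr(B^k) = Σ_{i=1}^l n_i μ_i^k for all k = 1,…,N; (ii) B = g·o·g⁻¹ for some g ∈ GL_N(ℂ). In other words, the conjugacy class of o is exactly the zero locus of the system (i). -/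
open Polynomial in
lemma aux_prod {ι : Type*} [Fintype ι] [DecidableEq ι] {l : ℕ} (μ : Fin l → ℂ)
    (B : Matrix ι ι ℂ) :
    (List.ofFn fun j : Fin l => B - μ j • (1 : Matrix ι ι ℂ)).prod
      = aeval B (∏ j, (X - C (μ j))) := by
  rw [← List.prod_ofFn, map_list_prod, List.map_ofFn]
  congr 2
  funext j
  simp [Algebra.algebraMap_eq_smul_one]

open Polynomial in
lemma aux_basis {V : Type*} [AddCommGroup V] [Module ℂ V] [FiniteDimensional ℂ V]
    {l : ℕ} (μ : Fin l → ℂ) (hμ : Function.Injective μ) (f : Module.End ℂ V)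
    (hf : aeval f (∏ j, (X - C (μ j))) = 0) (hl : 0 < l) :
    ∃ (d : Fin l → ℕ) (b : Module.Basis (Σ j : Fin l, Fin (d j)) ℂ V),
      ∀ x, f (b x) = μ x.1 • b x := by
  have hind : iSupIndep (fun j => f.eigenspace (μ j)) :=
    (Module.End.eigenspaces_iSupIndep f).comp hμ
  have htop : (⨆ j, f.eigenspace (μ j)) = ⊤ := by
    rw [eq_top_iff]
    intro v _
    have : Nonempty (Fin l) := ⟨⟨0, hl⟩⟩
    have h1 := Lagrange.sum_basis (s := Finset.univ) (v := μ) hμ.injOn Finset.univ_nonempty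
    have h2 : v = ∑ j, aeval f (Lagrange.basis Finset.univ μ j) v := by
      rw [← LinearMap.sum_apply, ← map_sum, h1]; simp
    rw [h2]
    refine Submodule.sum_mem _ fun j _ => ?_
    refine Submodule.mem_iSup_of_mem j ?_
    rw [Module.End.mem_eigenspace_iff, ← sub_eq_zero]
    have h3 : (X - C (μ j)) * Lagrange.basis Finset.univ μ j
        = C (∏ i ∈ Finset.univ.erase j, (μ j - μ i)⁻¹) * ∏ j, (X - C (μ j)) := by
      rw [← Finset.mul_prod_erase _ _ (Finset.mem_univ j), Lagrange.basis]
      simp only [Lagrange.basisDivisor, Finset.prod_mul_distrib, map_prod]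
      ring
    have h4 := congrArg (fun p => aeval f p v) h3
    simpa [hf, Module.algebraMap_end_apply] using h4
  have hint := DirectSum.isInternal_submodule_of_iSupIndep_of_iSup_eq_top hind htop
  refine ⟨fun j => Module.finrank ℂ (f.eigenspace (μ j)),
    hint.collectedBasis fun j => Module.finBasis ℂ _, fun x => ?_⟩
  exact Module.End.mem_eigenspace_iff.1 (hint.collectedBasis_mem _ x)

lemma aux_trace {l : ℕ} (d : Fin l → ℕ) (μ : Fin l → ℂ) (m : ℕ) :
    Matrix.trace ((Matrix.diagonal fun x : BlockIdx l d => μ x.1) ^ m)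
      = ∑ j, (d j : ℂ) * μ j ^ m := by
  rw [Matrix.diagonal_pow, Matrix.trace_diagonal, Fintype.sum_sigma]
  simp

lemma aux_trace' {ι : Type*} [Fintype ι] [DecidableEq ι] {l : ℕ} (d : Fin l → ℕ) (μ : Fin l → ℂ)
    (B : Matrix ι ι ℂ) (b : Module.Basis (Σ j : Fin l, Fin (d j)) ℂ (ι → ℂ))
    (hb : ∀ x, B.toLin' (b x) = μ x.1 • b x) (m : ℕ) :
    Matrix.trace (B ^ m) = ∑ j, (d j : ℂ) * μ j ^ m := by
  rw [← aux_trace]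
  have h : LinearMap.toMatrix b b B.toLin' = Matrix.diagonal fun x : BlockIdx l d => μ x.1 := by
    ext x y
    rw [LinearMap.toMatrix_apply, hb]
    simp only [map_smul, Module.Basis.repr_self, Finsupp.smul_apply, Finsupp.single_apply,
      Matrix.diagonal_apply, smul_eq_mul]
    by_cases hxy : x = y
    · simp [hxy]
    · simp [hxy, Ne.symm hxy]
  rw [← h, LinearMap.toMatrix_pow, ← LinearMap.trace_eq_matrix_trace, ← Matrix.toLin'_pow,
    Matrix.trace_toLin'_eq]

lemma aux_vander {l : ℕ} (d n : Fin l → ℕ) (μ : Fin l → ℂ) (hμ0 : ∀ j, μ j ≠ 0)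
    (hμ : Function.Injective μ)
    (h : ∀ m, 1 ≤ m → m ≤ l → ∑ j, (d j : ℂ) * μ j ^ m = ∑ j, (n j : ℂ) * μ j ^ m) : d = n := by
  have := Matrix.eq_zero_of_forall_pow_sum_mul_pow_eq_zero (f := μ)
    (v := fun j => ((d j : ℂ) - n j) * μ j) hμ (fun i => by
      have := h (i + 1) (by omega) (by omega)
      rw [← sub_eq_zero, ← Finset.sum_sub_distrib] at this
      rw [← this]
      refine Finset.sum_congr rfl fun j _ => ?_
      ring)
  funext j
  have h1 := congrFun this j
  simp only [Pi.zero_apply, mul_eq_zero, hμ0 j, or_false, sub_eq_zero] at h1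
  exact_mod_cast h1

/-- a matrix `B` satisfies `(B−μ_1)⋯(B−μ_l) = 0` and
`Tr(B^k) = Σ n_i μ_i^k` for `k = 1,…,N` if and only if `B` is conjugate to
`o = diag(μ_1·I_{n_1},…,μ_l·I_{n_l})` by an element of `GL_N(ℂ)`. -/
theorem gl_conjugacy_class_eq_zero_locus
    (N : ℕ) (hN : 1 ≤ N) (l : ℕ) (n : Fin l → ℕ) (hn : ∀ j, 0 < n j)
    (hsum : ∑ j, n j = N)
    (μ : Fin l → ℂ) (hμ0 : ∀ j, μ j ≠ 0) (hμ : Function.Injective μ) :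
    let o : Matrix (BlockIdx l n) (BlockIdx l n) ℂ := Matrix.diagonal fun x => μ x.1
    ∀ B : Matrix (BlockIdx l n) (BlockIdx l n) ℂ,
      (((List.ofFn fun j : Fin l =>
          B - μ j • (1 : Matrix (BlockIdx l n) (BlockIdx l n) ℂ)).prod = 0) ∧
        (∀ m ∈ Finset.Icc 1 N, Matrix.trace (B ^ m) = ∑ j, (n j : ℂ) * μ j ^ m))
      ↔ ∃ g : (Matrix (BlockIdx l n) (BlockIdx l n) ℂ)ˣ,
          B = (g : Matrix (BlockIdx l n) (BlockIdx l n) ℂ) * o *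
            ((g⁻¹ : (Matrix (BlockIdx l n) (BlockIdx l n) ℂ)ˣ) :
              Matrix (BlockIdx l n) (BlockIdx l n) ℂ) := by
  intro o B
  constructor
  · rintro ⟨h1, h2⟩
    have hl : 0 < l := by
      rcases Nat.eq_zero_or_pos l with h | h
      · subst h; simp at hsum; omega
      · exact h
    have hlN : l ≤ N := by
      calc l = ∑ j : Fin l, 1 := by simp
        _ ≤ ∑ j, n j := Finset.sum_le_sum fun j _ => hn j
        _ = N := hsum
    rw [aux_prod] at h1
    obtain ⟨d, b, hb⟩ := aux_basis μ hμ (Matrix.toLin' B) (by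
      have := congrArg (Matrix.toLinAlgEquiv' (R := ℂ)) h1
      rw [map_zero, ← Polynomial.aeval_algHom_apply] at this
      exact this) hl
    have hd : d = n := aux_vander d n μ hμ0 hμ fun m hm1 hm2 => by
      rw [← aux_trace' d μ B b hb, h2 m (Finset.mem_Icc.2 ⟨hm1, hm2.trans hlN⟩)]
    subst hd
    have e1 := (Pi.basisFun ℂ (BlockIdx l d)).toMatrix_mul_toMatrix_flip b
    have e2 := b.toMatrix_mul_toMatrix_flip (Pi.basisFun ℂ (BlockIdx l d))
    refine ⟨⟨(Pi.basisFun ℂ (BlockIdx l d)).toMatrix b,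
      b.toMatrix (Pi.basisFun ℂ (BlockIdx l d)), e1, e2⟩, ?_⟩
    have key : B * (Pi.basisFun ℂ (BlockIdx l d)).toMatrix b
        = (Pi.basisFun ℂ (BlockIdx l d)).toMatrix b * o := by
      ext x y
      have := congrFun (hb y) x
      rw [Matrix.mul_diagonal]
      simp only [Module.Basis.toMatrix_apply, Pi.basisFun_repr, Matrix.mul_apply]
      simp only [Matrix.toLin'_apply, Matrix.mulVec, dotProduct, Pi.smul_apply, smul_eq_mul] at this
      rw [this, mul_comm]
    change B = _ * o * b.toMatrix _
    rw [← key, Matrix.mul_assoc, e1, Matrix.mul_one]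
  · rintro ⟨g, rfl⟩
    refine ⟨?_, fun m _ => ?_⟩
    · have hL : ∀ L : List (Fin l),
          (L.map fun j => (g : Matrix (BlockIdx l n) (BlockIdx l n) ℂ) * o *
            ((g⁻¹ : (Matrix (BlockIdx l n) (BlockIdx l n) ℂ)ˣ) :
              Matrix (BlockIdx l n) (BlockIdx l n) ℂ)
              - μ j • (1 : Matrix (BlockIdx l n) (BlockIdx l n) ℂ)).prod
          = g * Matrix.diagonal (fun x : BlockIdx l n => (L.map fun j => μ x.1 - μ j).prod) *
            ((g⁻¹ : (Matrix (BlockIdx l n) (BlockIdx l n) ℂ)ˣ) :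
              Matrix (BlockIdx l n) (BlockIdx l n) ℂ) := by
        intro L
        induction L with
        | nil => simp
        | cons a L ih =>
          rw [List.map_cons, List.prod_cons, ih]
          have e : (Matrix.diagonal fun x : BlockIdx l n =>
              ((a :: L).map fun j => μ x.1 - μ j).prod)
              = (o - μ a • 1) * Matrix.diagonal
                (fun x : BlockIdx l n => (L.map fun j => μ x.1 - μ j).prod) := by
            rw [Matrix.smul_one_eq_diagonal, Matrix.diagonal_sub, Matrix.diagonal_mul_diagonal]
            simp
          rw [e]
          simp only [sub_mul, mul_sub, Matrix.mul_assoc, Units.inv_mul_cancel_left,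
            Matrix.smul_mul, Matrix.mul_smul, Matrix.one_mul]
      rw [List.ofFn_eq_map, hL]
      have : (fun x : BlockIdx l n => ((List.finRange l).map fun j => μ x.1 - μ j).prod)
          = fun _ => 0 := by
        funext x
        rw [List.prod_eq_zero_iff, List.mem_map]
        exact ⟨x.1, List.mem_finRange _, sub_self _⟩
      rw [this]
      simp
    · rw [Units.conj_pow, Matrix.trace_mul_cycle, Units.inv_mul, Matrix.one_mul, aux_trace]
end

section
/- Let n ≥ 1 and let C ∈ Mat_{2n}(ℂ) be the skew-symmetric matrix C_{ij} = ε_i δ_{i,2n+1−j}, where ε_i = 1 for 1 ≤ i ≤ n and ε_i = −1 for n+1 ≤ i ≤ 2n, and let G = Sp(2n,ℂ) = {A ∈ Mat_{2n}(ℂ) : A C Aᵀ = C}. Fix integers ℓ ≥ 0, m ≥ 1, p ≥ 1 and positive integers n_1,…,n_ℓ with n_1+…+n_ℓ+m+p = n, and complex numbers μ_1,…,μ_ℓ with μ_i ≠ 0, μ_i² ≠ 1, and μ_i ∉ {μ_j, μ_j⁻¹} for i ≠ j. Let o ∈ G be the diagonal matrix with diagonal entries (μ_1 repeated n_1 times,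 …, μ_ℓ repeated n_ℓ times, −1 repeated m times, 1 repeated 2p times, −1 repeated m times, μ_ℓ⁻¹ repeated n_ℓ times, …, μ_1⁻¹ repeated n_1 times). Then for B ∈ Mat_{2n}(ℂ) the following are equivalent: (i) B C Bᵀ = C, (B − μ_1)⋯(B − μ_ℓ)(B + 1)(B − 1)(B − μ_ℓ⁻¹)⋯(B − μ_1⁻¹) = 0, and Tr(B^k) = Σ_{i=1}^ℓ n_i(μ_i^k + μ_i^{−k}) + 2m(−1)^k + 2p for k = 1,…,2n; (ii) B = g·o·g⁻¹ for some g ∈ G. In other words, the conjugacy class of o in the symplectic group is exactly the set of solutions of the system (i). -/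
open Matrix

open Polynomial in
theorem aux_sqrt {N : ℕ} (S : Matrix (Fin N) (Fin N) ℂ) (hS : IsUnit S) :
    ∃ q : ℂ[X], (aeval S q) * (aeval S q) = S := by
  classical
  set χ := S.charpoly with hχ
  have hex : ∀ a : ℂ, ∃ b : ℂ, b * b = a := fun a => by
    obtain ⟨b, hb⟩ := IsAlgClosed.exists_pow_nat_eq a (n := 2) (by norm_num)
    exact ⟨b, by rw [← hb, sq]⟩
  choose s hs using hex
  set q0 : ℂ[X] := Lagrange.interpolate χ.roots.toFinset id s with hq0
  have hsplit : χ = (χ.roots.map (fun a => X - C a)).prod := by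
    have := (IsAlgClosed.splits χ).eq_prod_roots
    rwa [(Matrix.charpoly_monic S).leadingCoeff, C_1, one_mul] at this
  have hdiv : ∀ a ∈ χ.roots, (X - C a) ∣ (q0 * q0 - X) := by
    intro a ha
    rw [dvd_iff_isRoot, IsRoot.def]
    have : q0.eval a = s a := by
      have := Lagrange.eval_interpolate_at_node (s := χ.roots.toFinset) (v := id) s
        (Function.injective_id.injOn) (i := a) (by simpa using ha)
      exact this
    simp [this, hs]
  have key : ∀ (f : ℂ[X]) (M : Multiset ℂ), (∀ a ∈ M, (X - C a) ∣ f) →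
      (M.map (fun a => X - C a)).prod ∣ f ^ (Multiset.card M) := by
    intro f M
    induction M using Multiset.induction_on with
    | empty => simp
    | cons a M ih =>
      intro h
      rw [Multiset.map_cons, Multiset.prod_cons, Multiset.card_cons, pow_succ, mul_comm]
      exact mul_dvd_mul (ih fun b hb => h b (by simp [hb])) (h a (by simp))
  have hdvd : χ ∣ (q0 * q0 - X) ^ (Multiset.card χ.roots) := by
    conv_lhs => rw [hsplit]
    exact key _ _ hdiv
  let x : AdjoinRoot χ := AdjoinRoot.mk χ q0
  let t : AdjoinRoot χ := AdjoinRoot.mk χ X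
  have hnil : IsNilpotent (x * x - t) := by
    refine ⟨Multiset.card χ.roots, ?_⟩
    have := AdjoinRoot.mk_eq_zero.2 hdvd
    simpa [x, t] using this
  have ht : IsUnit t := by
    have hc : IsCoprime (X : ℂ[X]) χ := by
      refine (Polynomial.irreducible_X.coprime_iff_not_dvd).2 ?_
      rw [X_dvd_iff]
      intro h0
      have h1 := Matrix.det_eq_sign_charpoly_coeff S
      rw [← hχ, h0, mul_zero] at h1
      have := (Matrix.isUnit_iff_isUnit_det S).1 hS
      rw [h1] at this
      exact not_isUnit_zero this
    obtain ⟨a, b, hab⟩ := hc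
    have h2 := congrArg (AdjoinRoot.mk χ) hab
    rw [map_add, map_mul, map_mul, AdjoinRoot.mk_self, mul_zero, add_zero, map_one] at h2
    exact IsUnit.of_mul_eq_one (AdjoinRoot.mk χ a) (by rw [mul_comm]; exact h2)
  have hx : IsUnit x := by
    have : IsUnit (x * x) := by
      have h := IsNilpotent.isUnit_add_left_of_commute hnil ht (Commute.all _ _)
      rwa [add_sub_cancel] at h
    exact isUnit_of_mul_isUnit_left this
  have h2 : IsUnit (2 : AdjoinRoot χ) := by
    have : IsUnit (algebraMap ℂ (AdjoinRoot χ) 2) := (IsUnit.mk0 (2:ℂ) two_ne_zero).map _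
    rwa [map_ofNat] at this
  obtain ⟨r, ⟨-, hr⟩, -⟩ := Polynomial.existsUnique_nilpotent_sub_and_aeval_eq_zero
    (P := (X ^ 2 - C t : (AdjoinRoot χ)[X])) (x := x)
    (by simpa [sq] using hnil) (by simpa [one_add_one_eq_two] using And.intro h2 hx)
  obtain ⟨q, rfl⟩ := AdjoinRoot.mk_surjective r
  refine ⟨q, ?_⟩
  have hd : χ ∣ q * q - X := by
    rw [← AdjoinRoot.mk_eq_zero]
    simpa [sq, t] using hr
  obtain ⟨w, hw⟩ := hd
  have := congrArg (aeval S) hw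
  rw [map_mul, hχ, Matrix.aeval_self_charpoly, zero_mul, map_sub, map_mul, aeval_X] at this
  exact sub_eq_zero.1 this

open Polynomial in
theorem aux_diag {N : ℕ} (B : Matrix (Fin N) (Fin N) ℂ) (P : ℂ[X]) (hP : Squarefree P)
    (hB : aeval B P = 0) :
    ∃ (h : (Matrix (Fin N) (Fin N) ℂ)ˣ) (c : Fin N → ℂ),
      B * (h : Matrix (Fin N) (Fin N) ℂ) = h * diagonal c := by
  classical
  set f : Module.End ℂ (Fin N → ℂ) := Matrix.toLinAlgEquiv' B with hf
  have hss : f.IsSemisimple := by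
    refine Module.End.isSemisimple_of_squarefree_aeval_eq_zero hP ?_
    rw [hf, aeval_algHom_apply, hB, map_zero]
  have htop : ⨆ a : ℂ, f.eigenspace a = ⊤ :=
    hss.iSup_maxGenEigenspace_eq_top_iff.1 (Module.End.iSup_maxGenEigenspace_eq_top f)
  have hint := DirectSum.isInternal_submodule_of_iSupIndep_of_iSup_eq_top
    (Module.End.eigenspaces_iSupIndep f) htop
  obtain ⟨b, c, hb⟩ : ∃ (b : Module.Basis (Fin N) ℂ (Fin N → ℂ)) (c : Fin N → ℂ),
      ∀ j, f (b j) = c j • b j := by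
    refine ⟨(hint.collectedBasis (fun a => Module.finBasis ℂ (f.eigenspace a))).reindex
      ((hint.collectedBasis (fun a => Module.finBasis ℂ (f.eigenspace a))).indexEquiv
        (Pi.basisFun ℂ (Fin N))), fun j =>
      (((hint.collectedBasis (fun a => Module.finBasis ℂ (f.eigenspace a))).indexEquiv
        (Pi.basisFun ℂ (Fin N))).symm j).1, fun j => ?_⟩
    have := hint.collectedBasis_mem (fun a => Module.finBasis ℂ (f.eigenspace a))
      (((hint.collectedBasis (fun a => Module.finBasis ℂ (f.eigenspace a))).indexEquiv
        (Pi.basisFun ℂ (Fin N))).symm j)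
    rw [Module.End.mem_eigenspace_iff] at this
    rw [Module.Basis.reindex_apply]
    exact this
  let I := (Pi.basisFun ℂ (Fin N)).invertibleToMatrix b
  refine ⟨unitOfInvertible ((Pi.basisFun ℂ (Fin N)).toMatrix b), c, ?_⟩
  ext i j
  have h1 : (B *ᵥ b j) i = c j * b j i := congrFun (hb j) i
  rw [val_unitOfInvertible, mul_diagonal, Matrix.mul_apply]
  simp only [Module.Basis.toMatrix_apply, Pi.basisFun_repr]
  rw [mul_comm, ← h1]
  rfl

open Polynomial in
theorem aux_conj {N : ℕ} (C o B h : Matrix (Fin N) (Fin N) ℂ) (hC : Cᵀ = -C) (hC2 : C * C = -1)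
    (ho : oᵀ = o) (hoC : o * C * o = C) (hB : B * C * Bᵀ = C) (hh : IsUnit h)
    (hBh : B * h = h * o) :
    ∃ g : (Matrix (Fin N) (Fin N) ℂ)ˣ, (g : Matrix (Fin N) (Fin N) ℂ) * C * (g.1)ᵀ = C ∧
      B = g.1 * o * (g⁻¹).1 := by
  obtain ⟨u, rfl⟩ := hh
  set v : Matrix (Fin N) (Fin N) ℂ := (u⁻¹).1 with hv
  have huv : u.1 * v = 1 := u.mul_inv
  have hvu : v * u.1 = 1 := u.inv_mul
  have huvT : vᵀ * u.1ᵀ = 1 := by rw [← transpose_mul, huv, transpose_one]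
  have hvuT : u.1ᵀ * vᵀ = 1 := by rw [← transpose_mul, hvu, transpose_one]
  set D := v * C * vᵀ with hD
  have hvB : v * B = o * v := by
    calc v * B = v * (B * u.1) * v := by rw [mul_assoc v, mul_assoc B, huv, mul_one]
      _ = v * u.1 * o * v := by rw [hBh]; simp only [mul_assoc]
      _ = o * v := by rw [hvu, one_mul]
  have hvBT : Bᵀ * vᵀ = vᵀ * o := by
    have := congrArg transpose hvB
    simpa [transpose_mul, ho] using this
  have hoD : o * D * o = D := by
    calc o * D * o = (o * v) * C * (vᵀ * o) := by simp only [hD, mul_assoc]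
      _ = v * (B * C * Bᵀ) * vᵀ := by rw [← hvB, ← hvBT]; simp only [mul_assoc]
      _ = D := by rw [hB]
  have hDT : Dᵀ = -D := by simp [hD, transpose_mul, hC, mul_assoc]
  set S := -(D * C) with hS
  have hSC : S * C = D := by rw [hS, neg_mul, mul_assoc, hC2, mul_neg, mul_one, neg_neg]
  have hCS : C * Sᵀ = S * C := by
    rw [hSC, hS, transpose_neg, transpose_mul, hC, hDT, neg_mul_neg, mul_neg, ← mul_assoc, hC2,
      neg_one_mul, neg_neg]
  have hCu : IsUnit C := IsUnit.of_mul_eq_one (-C) (by rw [mul_neg, hC2, neg_neg])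
  have hou : IsUnit o := by
    refine IsUnit.of_mul_eq_one (C * o * (-C)) ?_
    rw [← mul_assoc, ← mul_assoc, hoC, mul_neg, hC2, neg_neg]
  have hSo : Commute S o := by
    -- o C o = C ; o (C o C) = -1
    have h1 : o * C * o * C = -1 := by rw [hoC, hC2]
    have h1' : (C * o * C) * o = -1 := by
      have : o * (-(C * o * C)) = 1 := by
        rw [mul_neg, ← mul_assoc, ← mul_assoc, h1, neg_neg]
      have := mul_eq_one_comm.1 this
      rw [neg_mul] at this
      rw [← this, neg_neg]
    have h2 : C * o = o⁻¹ * C := by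
      have hdet := (Matrix.isUnit_iff_isUnit_det o).1 hou
      calc C * o = o⁻¹ * (o * C * o) := by
            rw [mul_assoc o, ← mul_assoc o⁻¹, Matrix.nonsing_inv_mul _ hdet, one_mul]
        _ = _ := by rw [hoC]
    have h3 : o * D = D * o⁻¹ := by
      have hdet := (Matrix.isUnit_iff_isUnit_det o).1 hou
      calc o * D = (o * D * o) * o⁻¹ := by
            rw [mul_assoc _ o, Matrix.mul_nonsing_inv _ hdet, mul_one]
        _ = _ := by rw [hoD]
    show S * o = o * S
    rw [hS, neg_mul, mul_neg, mul_assoc, h2, ← mul_assoc, ← mul_assoc, h3]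
  have hSu : IsUnit S := by
    have hvu : IsUnit v := (u⁻¹).isUnit
    have : IsUnit vᵀ := IsUnit.of_mul_eq_one _ huvT
    exact (((hvu.mul hCu).mul this).mul hCu).neg
  obtain ⟨q, hq⟩ := aux_sqrt S hSu
  set R := aeval S q with hR
  have hRo : Commute R o := by
    rw [hR]
    refine Polynomial.induction_on q ?_ ?_ ?_
    · intro a; rw [aeval_C]; exact Algebra.commutes a o
    · intro p r hp hr; rw [map_add]; exact hp.add_left hr
    · intro n a _
      rw [map_mul, aeval_C, map_pow, aeval_X]
      exact Commute.mul_left (Algebra.commutes a o) (hSo.pow_left _)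
  have hRC : C * Rᵀ = R * C := by
    have hpow : ∀ k : ℕ, C * (S ^ k)ᵀ = S ^ k * C := by
      intro k
      induction k with
      | zero => simp
      | succ k ih => rw [pow_succ, transpose_mul, ← mul_assoc, hCS, mul_assoc, ih, ← mul_assoc,
          ← pow_succ', ← pow_succ]
    rw [hR, aeval_eq_sum_range, transpose_sum, Finset.mul_sum, Finset.sum_mul]
    refine Finset.sum_congr rfl fun k _ => ?_
    rw [transpose_smul, mul_smul_comm, smul_mul_assoc, hpow]
  have hRu : IsUnit R := by
    rw [← hq] at hSu
    rw [Matrix.isUnit_iff_isUnit_det, det_mul] at hSu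
    exact (Matrix.isUnit_iff_isUnit_det _).2 (isUnit_of_mul_isUnit_left hSu)
  obtain ⟨k, hk⟩ := hRu
  refine ⟨u * k, ?_, ?_⟩
  · rw [Units.val_mul, transpose_mul, hk]
    calc u.1 * R * C * (Rᵀ * u.1ᵀ) = u.1 * (R * (C * Rᵀ)) * u.1ᵀ := by simp only [mul_assoc]
      _ = u.1 * D * u.1ᵀ := by rw [hRC, ← mul_assoc R, hq, hSC]
      _ = (u.1 * v) * C * (vᵀ * u.1ᵀ) := by simp only [hD, mul_assoc]
      _ = C := by rw [huv, huvT, one_mul, mul_one]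
  · rw [Units.eq_mul_inv_iff_mul_eq, Units.val_mul, hk, ← mul_assoc, hBh, mul_assoc, mul_assoc,
      hRo.eq]

theorem aux_count {N : ℕ} (Λ : Finset ℂ) (hΛ : Λ.card ≤ N + 1) (c d : Fin N → ℂ)
    (hc : ∀ i, c i ∈ Λ) (hd : ∀ i, d i ∈ Λ)
    (hs : ∀ r ∈ Finset.Icc 1 N, ∑ i, c i ^ r = ∑ i, d i ^ r) :
    ∃ τ : Equiv.Perm (Fin N), ∀ i, c i = d (τ i) := by
  classical
  have hs' : ∀ r < N + 1, ∑ i, c i ^ r = ∑ i, d i ^ r := by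
    intro r hr
    rcases Nat.eq_zero_or_pos r with rfl | h
    · simp
    · exact hs r (Finset.mem_Icc.2 ⟨h, by omega⟩)
  have hpoly : ∀ f : Polynomial ℂ, f.degree < (N + 1 : ℕ) →
      ∑ i, f.eval (c i) = ∑ i, f.eval (d i) := by
    intro f hf
    have hf' : f.natDegree < N + 1 := by
      by_cases h0 : f = 0
      · simp [h0]
      · exact (Polynomial.natDegree_lt_iff_degree_lt h0).2 hf
    simp_rw [Polynomial.eval_eq_sum_range' hf']
    rw [Finset.sum_comm, Finset.sum_comm (s := Finset.univ)]
    refine Finset.sum_congr rfl fun r hr => ?_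
    rw [← Finset.mul_sum, ← Finset.mul_sum, hs' r (Finset.mem_range.1 hr)]
  have hcard : ∀ a : ℂ, Fintype.card {i // c i = a} = Fintype.card {i // d i = a} := by
    intro a
    by_cases ha : a ∈ Λ
    · let s : ℂ → ℂ := fun b => if b = a then 1 else 0
      have hev : ∀ b ∈ Λ, (Lagrange.interpolate Λ id s).eval b = s b := by
        intro b hb
        simpa using Lagrange.eval_interpolate_at_node (s := Λ) (v := id) s
          (Function.injective_id.injOn) (i := b) hb
      have h := hpoly (Lagrange.interpolate Λ id s)
        ((Lagrange.degree_interpolate_lt (s := Λ) (v := id) s Function.injective_id.injOn).trans_le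
          (by exact_mod_cast hΛ))
      simp_rw [hev _ (hc _), hev _ (hd _)] at h
      simp only [s, Finset.sum_boole] at h
      rw [Fintype.card_subtype, Fintype.card_subtype]
      exact_mod_cast h
    · have h1 : IsEmpty {i // c i = a} := ⟨fun i => ha (i.2 ▸ hc i.1)⟩
      have h2 : IsEmpty {i // d i = a} := ⟨fun i => ha (i.2 ▸ hd i.1)⟩
      simp
  have F := fun a => Classical.choice (Fintype.card_eq.1 (hcard a))
  refine ⟨Equiv.ofFiberEquiv F, fun i => (Equiv.ofFiberEquiv_map F i).symm⟩

theorem aux_sum_getD (f : ℂ → ℂ) (l : List ℂ) (N : ℕ) (h : l.length = N) :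
    ∑ i : Fin N, f (l.getD (i : ℕ) 0) = (l.map f).sum := by
  subst h
  rw [← Fin.sum_univ_fun_getElem]
  refine Finset.sum_congr rfl fun i _ => ?_
  simp

theorem aux_rev (l : List ℂ) (N : ℕ) (h : l.length = N) (h0 : ∀ a ∈ l, a ≠ 0)
    (hr : l.reverse = l.map (fun a => a⁻¹)) (i j : ℕ) (hij : i + j = N - 1) (hi : i < N) :
    l.getD i 0 * l.getD j 0 = 1 := by
  subst h
  have hj : j < l.length := by omega
  rw [List.getD_eq_getElem _ _ hi, List.getD_eq_getElem _ _ hj]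
  have h1 : l.reverse[j]'(by simpa using hj) = (l.map (fun a => a⁻¹))[j]'(by simpa using hj) := by
    simp only [hr]
  rw [List.getElem_reverse, List.getElem_map] at h1
  have h2 : l.length - 1 - j = i := by omega
  simp only [h2] at h1
  rw [h1]
  exact inv_mul_cancel₀ (h0 _ (List.getElem_mem _))

open Polynomial in
theorem aux_aeval_conj {N : ℕ} (B h o : Matrix (Fin N) (Fin N) ℂ) (H : B * h = h * o) (P : ℂ[X]) :
    aeval B P * h = h * aeval o P := by
  have hpow : ∀ k : ℕ, B ^ k * h = h * o ^ k := by
    intro k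
    induction k with
    | zero => simp
    | succ k ih => rw [pow_succ, mul_assoc, H, ← mul_assoc, ih, mul_assoc, ← pow_succ]
  rw [aeval_eq_sum_range, aeval_eq_sum_range, Finset.mul_sum, Finset.sum_mul]
  refine Finset.sum_congr rfl fun k _ => ?_
  rw [mul_smul_comm, smul_mul_assoc, hpow]

open Polynomial in
theorem aux_aeval_diag {N : ℕ} (d : Fin N → ℂ) (P : ℂ[X]) :
    aeval (diagonal d) P = diagonal (fun i => P.eval (d i)) := by
  induction P using Polynomial.induction_on' with
  | add p q hp hq => simp [hp, hq]
  | monomial k a =>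
    ext i j
    by_cases hij : i = j
    · subst hij
      simp [aeval_monomial, diagonal_pow, Algebra.algebraMap_eq_smul_one]
    · simp [aeval_monomial, diagonal_pow, Algebra.algebraMap_eq_smul_one, hij]

theorem aux_trace_s8 {N : ℕ} (B o : Matrix (Fin N) (Fin N) ℂ) (h : (Matrix (Fin N) (Fin N) ℂ)ˣ)
    (H : B * h.1 = h.1 * o) (r : ℕ) : trace (B ^ r) = trace (o ^ r) := by
  have h1 := aux_aeval_conj B h.1 o H (Polynomial.X ^ r)
  simp only [map_pow, Polynomial.aeval_X] at h1
  have h2 : B ^ r = h.1 * o ^ r * (h⁻¹).1 := by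
    rw [Units.eq_mul_inv_iff_mul_eq, h1]
  rw [h2, trace_units_conj]

theorem aux_Cm (n : ℕ) (Cm : Matrix (Fin (2 * n)) (Fin (2 * n)) ℂ)
    (hCm : Cm = Matrix.of fun (i j : Fin (2 * n)) =>
        if (i : ℕ) + (j : ℕ) = 2 * n - 1 then (if (i : ℕ) < n then 1 else -1) else 0) :
    Cmᵀ = -Cm ∧ Cm * Cm = -1 := by
  subst hCm
  constructor
  · ext i j
    have := i.2
    have := j.2
    simp only [transpose_apply, of_apply, Matrix.neg_apply]
    split_ifs <;> first | omega | simp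
  · ext i j
    have := i.2
    have := j.2
    rw [Matrix.mul_apply, Finset.sum_eq_single i.rev]
    · simp only [of_apply, Matrix.neg_apply, Fin.val_rev, Matrix.one_apply, Fin.ext_iff]
      split_ifs <;> first | omega | simp
    · intro b _ hb
      have := b.2
      simp only [ne_eq, Fin.ext_iff, Fin.val_rev] at hb
      simp only [of_apply]
      rw [if_neg (by omega), zero_mul]
    · simp

theorem aux_main (n : ℕ) (L dl : List ℂ) (hLn : L.Nodup) (hLl : L.length ≤ 2 * n + 1)
    (hdl : dl.length = 2 * n) (h0 : ∀ a ∈ dl, a ≠ 0) (hdL : ∀ a ∈ dl, a ∈ L)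
    (hr : dl.reverse = dl.map (fun a => a⁻¹)) (T : ℕ → ℂ)
    (hT : ∀ r, (dl.map (fun a => a ^ r)).sum = T r)
    (Cm : Matrix (Fin (2 * n)) (Fin (2 * n)) ℂ)
    (hCm : Cm = Matrix.of fun (i j : Fin (2 * n)) =>
        if (i : ℕ) + (j : ℕ) = 2 * n - 1 then (if (i : ℕ) < n then 1 else -1) else 0)
    (o : Matrix (Fin (2 * n)) (Fin (2 * n)) ℂ)
    (ho : o = Matrix.diagonal fun (i : Fin (2 * n)) => dl.getD (i : ℕ) 0)
    (B : Matrix (Fin (2 * n)) (Fin (2 * n)) ℂ) :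
    (B * Cm * Bᵀ = Cm ∧
      (L.map fun a => B - a • (1 : Matrix (Fin (2 * n)) (Fin (2 * n)) ℂ)).prod = 0 ∧
      (∀ r ∈ Finset.Icc 1 (2 * n), Matrix.trace (B ^ r) = T r))
      ↔ ∃ g : (Matrix (Fin (2 * n)) (Fin (2 * n)) ℂ)ˣ,
          (g : Matrix (Fin (2 * n)) (Fin (2 * n)) ℂ) * Cm *
              ((g : Matrix (Fin (2 * n)) (Fin (2 * n)) ℂ))ᵀ = Cm ∧
          B = (g : Matrix (Fin (2 * n)) (Fin (2 * n)) ℂ) * o *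
            ((g⁻¹ : (Matrix (Fin (2 * n)) (Fin (2 * n)) ℂ)ˣ) :
              Matrix (Fin (2 * n)) (Fin (2 * n)) ℂ) := by
  classical
  obtain ⟨hC1, hC2⟩ := aux_Cm n Cm hCm
  set P : Polynomial ℂ := ∏ a ∈ L.toFinset, (Polynomial.X - Polynomial.C a) with hP
  have hPsq : Squarefree P := by
    refine Polynomial.Separable.squarefree ?_
    exact Polynomial.separable_prod_X_sub_C_iff'.2 (fun x _ y _ h => h)
  have hPB : (L.map fun a => B - a • (1 : Matrix (Fin (2 * n)) (Fin (2 * n)) ℂ)).prod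
      = Polynomial.aeval B P := by
    rw [hP, List.prod_toFinset _ hLn, map_list_prod, List.map_map]
    congr 1
    refine List.map_congr_left fun a _ => ?_
    simp [Algebra.algebraMap_eq_smul_one]
  have hPe : ∀ x, P.eval x = 0 ↔ x ∈ L := by
    intro x
    rw [hP, Polynomial.eval_prod, Finset.prod_eq_zero_iff]
    simp [sub_eq_zero]
  set d : Fin (2 * n) → ℂ := fun i => dl.getD (i : ℕ) 0 with hd
  have hdm : ∀ i, d i ∈ dl := by
    intro i
    have hi : (i : ℕ) < dl.length := by rw [hdl]; exact i.2
    simp only [hd]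
    rw [List.getD_eq_getElem _ _ hi]
    exact List.getElem_mem _
  have hoT : oᵀ = o := by rw [ho, diagonal_transpose]
  have hoC : o * Cm * o = Cm := by
    ext i j
    rw [ho, mul_diagonal, diagonal_mul, hCm]
    simp only [of_apply]
    split_ifs with h1 h2
    · rw [mul_one, hd]; exact aux_rev dl _ hdl h0 hr i j h1 i.2
    · have := aux_rev dl _ hdl h0 hr i j h1 i.2
      rw [mul_neg, mul_one, neg_mul, hd]
      exact congrArg Neg.neg this
    · simp
  have htr : ∀ r, trace (o ^ r) = T r := by
    intro r
    rw [ho, diagonal_pow, trace_diagonal, ← hT, ← aux_sum_getD _ dl (2 * n) hdl]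
    rfl
  rw [hPB]
  constructor
  · rintro ⟨hB, hBP, hBT⟩
    obtain ⟨h, c, hh⟩ := aux_diag B P hPsq hBP
    have hc : ∀ i, c i ∈ L := by
      intro i
      have h1 := aux_aeval_conj B h.1 _ hh P
      rw [hBP, zero_mul, aux_aeval_diag] at h1
      have h2 : diagonal (fun i => P.eval (c i)) = 0 := by
        have := congrArg (fun M => (h⁻¹).1 * M) h1
        simpa using this.symm
      have h3 := congrFun (congrFun h2 i) i
      rw [diagonal_apply_eq] at h3
      exact (hPe _).1 h3
    obtain ⟨τ, hτ⟩ := aux_count L.toFinset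
      ((List.toFinset_card_le L).trans hLl) c d (fun i => by simpa using hc i)
      (fun i => by simpa using hdL _ (hdm i)) (by
        intro r hr
        have h1 := hBT r hr
        rw [aux_trace_s8 B _ h hh, ← htr, ho, diagonal_pow, diagonal_pow, trace_diagonal,
          trace_diagonal] at h1
        exact h1)
    refine aux_conj Cm o B (h.1.submatrix (Equiv.refl _) τ.symm) hC1 hC2 hoT hoC hB
      ((isUnit_submatrix_equiv _ _).2 h.isUnit) ?_
    ext i j
    have h1 := congrFun (congrFun hh i) (τ.symm j)
    rw [mul_diagonal, hτ] at h1
    rw [ho, mul_diagonal]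
    simpa [Matrix.mul_apply] using h1
  · rintro ⟨g, hg, hB⟩
    have hBg : B * g.1 = g.1 * o := (Units.eq_mul_inv_iff_mul_eq g).1 hB
    refine ⟨?_, ?_, fun r _ => by rw [aux_trace_s8 B o g hBg, htr]⟩
    · conv_lhs => rw [← hg]
      calc B * (g.1 * Cm * g.1ᵀ) * Bᵀ = (B * g.1) * Cm * (B * g.1)ᵀ := by
            simp only [transpose_mul, mul_assoc]
        _ = g.1 * (o * Cm * o) * g.1ᵀ := by
            rw [hBg, transpose_mul, hoT]; simp only [mul_assoc]
        _ = Cm := by rw [hoC, hg]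
    · have h1 := aux_aeval_conj B g.1 _ hBg P
      have h2 : Polynomial.aeval o P = 0 := by
        rw [ho, aux_aeval_diag]
        ext i j
        by_cases hij : i = j
        · subst hij; simpa using (hPe _).2 (hdL _ (hdm i))
        · simp [hij]
      rw [h2, mul_zero] at h1
      simpa using congrArg (fun M => M * (g⁻¹).1) h1


/-- a matrix `B` is symplectic (`B C Bᵀ = C`), satisfies the minimal
polynomial `(B−μ_1)⋯(B−μ_ℓ)(B+1)(B−1)(B−μ_ℓ⁻¹)⋯(B−μ_1⁻¹) = 0` and the trace
relations `Tr(B^k) = Σ n_i(μ_i^k + μ_i^{−k}) + 2m(−1)^k + 2p`, `k = 1,…,2n`, if and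
only if `B` is conjugate, by an element of `Sp(2n,ℂ)`, to the diagonal matrix `o`
with entries `(μ_1^{n_1},…,μ_ℓ^{n_ℓ},(−1)^m,1^{2p},(−1)^m,μ_ℓ^{-n_ℓ},…,μ_1^{-n_1})`. -/
theorem sp_conjugacy_class_eq_zero_locus
    (n : ℕ) (hn : 1 ≤ n) (ℓ m p : ℕ) (hm : 1 ≤ m) (hp : 1 ≤ p)
    (nn : Fin ℓ → ℕ) (hnn : ∀ j, 0 < nn j)
    (μ : Fin ℓ → ℂ) (hμ0 : ∀ j, μ j ≠ 0) (hμ1 : ∀ j, μ j ^ 2 ≠ 1)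
    (hμ : ∀ i j, i ≠ j → μ i ≠ μ j ∧ μ i ≠ (μ j)⁻¹)
    (hsum : (∑ j, nn j) + m + p = n) :
    let Cm : Matrix (Fin (2 * n)) (Fin (2 * n)) ℂ :=
      Matrix.of fun i j =>
        if (i : ℕ) + (j : ℕ) = 2 * n - 1 then (if (i : ℕ) < n then 1 else -1) else 0
    let dlist : List ℂ :=
      ((List.ofFn fun j : Fin ℓ => List.replicate (nn j) (μ j)).flatten)
        ++ List.replicate m (-1) ++ List.replicate (2 * p) 1 ++ List.replicate m (-1)
        ++ (((List.ofFn fun j : Fin ℓ => List.replicate (nn j) (μ j)⁻¹).flatten).reverse)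
    let o : Matrix (Fin (2 * n)) (Fin (2 * n)) ℂ :=
      Matrix.diagonal fun i => dlist.getD (i : ℕ) 0
    ∀ B : Matrix (Fin (2 * n)) (Fin (2 * n)) ℂ,
      (B * Cm * Bᵀ = Cm ∧
        ((List.ofFn fun j : Fin ℓ =>
            B - μ j • (1 : Matrix (Fin (2 * n)) (Fin (2 * n)) ℂ))
          ++ [B + 1, B - 1]
          ++ (List.ofFn fun j : Fin ℓ =>
            B - (μ j)⁻¹ • (1 : Matrix (Fin (2 * n)) (Fin (2 * n)) ℂ)).reverse).prod = 0 ∧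
        (∀ r ∈ Finset.Icc 1 (2 * n),
          Matrix.trace (B ^ r) =
            (∑ j, (nn j : ℂ) * (μ j ^ r + (μ j)⁻¹ ^ r))
              + 2 * (m : ℂ) * (-1) ^ r + 2 * (p : ℂ)))
      ↔ ∃ g : (Matrix (Fin (2 * n)) (Fin (2 * n)) ℂ)ˣ,
          (g : Matrix (Fin (2 * n)) (Fin (2 * n)) ℂ) * Cm *
              ((g : Matrix (Fin (2 * n)) (Fin (2 * n)) ℂ))ᵀ = Cm ∧
          B = (g : Matrix (Fin (2 * n)) (Fin (2 * n)) ℂ) * o *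
            ((g⁻¹ : (Matrix (Fin (2 * n)) (Fin (2 * n)) ℂ)ˣ) :
              Matrix (Fin (2 * n)) (Fin (2 * n)) ℂ) := by
  intro Cm dlist o B
  have hm1 : ∀ j, μ j ≠ 1 := fun j h => hμ1 j (by rw [h]; norm_num)
  have hm2 : ∀ j, μ j ≠ -1 := fun j h => hμ1 j (by rw [h]; norm_num)
  have hmi : ∀ j, μ j ≠ (μ j)⁻¹ := fun j h => hμ1 j (by
    rw [sq]; nth_rewrite 2 [h]; exact mul_inv_cancel₀ (hμ0 j))
  have hinj : Function.Injective μ := fun i j h => by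
    by_contra hne
    exact (hμ i j hne).1 h
  have hLmem : ∀ a, a ∈ ((List.ofFn μ) ++ [-1, 1] ++ (List.ofFn fun j => (μ j)⁻¹).reverse) ↔
      (∃ j, μ j = a) ∨ a = -1 ∨ a = 1 ∨ ∃ j, (μ j)⁻¹ = a := by
    intro a
    simp [List.mem_ofFn, or_assoc]
  have hdmem : ∀ a ∈ dlist,
      (∃ j, μ j = a) ∨ a = -1 ∨ a = 1 ∨ ∃ j, (μ j)⁻¹ = a := by
    intro a ha
    simp only [dlist, List.mem_append, List.mem_flatten, List.mem_ofFn, List.mem_reverse,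
      List.mem_replicate] at ha
    rcases ha with (((⟨l, ⟨j, rfl⟩, hl⟩ | ⟨-, rfl⟩) | ⟨-, rfl⟩) | ⟨-, rfl⟩) | ⟨l, ⟨j, rfl⟩, hl⟩
    · exact Or.inl ⟨j, (List.eq_of_mem_replicate hl).symm⟩
    · simp
    · simp
    · simp
    · exact Or.inr (Or.inr (Or.inr ⟨j, (List.eq_of_mem_replicate hl).symm⟩))
  have hℓ : ℓ ≤ ∑ j, nn j := by
    have : ∑ j : Fin ℓ, 1 ≤ ∑ j, nn j := Finset.sum_le_sum fun j _ => hnn j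
    simpa using this
  have key := aux_main n ((List.ofFn μ) ++ [-1, 1] ++ (List.ofFn fun j => (μ j)⁻¹).reverse) dlist
    ?_ ?_ ?_ ?_ ?_ ?_
    (fun r => (∑ j, (nn j : ℂ) * (μ j ^ r + (μ j)⁻¹ ^ r)) + 2 * (m : ℂ) * (-1) ^ r + 2 * (p : ℂ))
    ?_ Cm rfl o rfl B
  · rw [← key]
    have : (((List.ofFn μ) ++ [-1, 1] ++ (List.ofFn fun j => (μ j)⁻¹).reverse).map
        fun a => B - a • (1 : Matrix (Fin (2 * n)) (Fin (2 * n)) ℂ)) =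
        ((List.ofFn fun j : Fin ℓ =>
            B - μ j • (1 : Matrix (Fin (2 * n)) (Fin (2 * n)) ℂ))
          ++ [B + 1, B - 1]
          ++ (List.ofFn fun j : Fin ℓ =>
            B - (μ j)⁻¹ • (1 : Matrix (Fin (2 * n)) (Fin (2 * n)) ℂ)).reverse) := by
      simp only [List.map_append, List.map_reverse, List.map_ofFn, List.map_cons, List.map_nil,
        neg_smul, one_smul, sub_neg_eq_add]
      rfl
    rw [this]
  · rw [List.nodup_append, List.nodup_append, List.nodup_reverse, List.nodup_ofFn,
      List.nodup_ofFn]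
    refine ⟨⟨hinj, ?_, ?_⟩, inv_injective.comp hinj, ?_⟩
    · norm_num
    · intro a ha b hb
      obtain ⟨j, rfl⟩ := (List.mem_ofFn' _ _).1 ha
      simp only [List.mem_cons, List.not_mem_nil, or_false] at hb
      rcases hb with rfl | rfl
      · exact hm2 j
      · exact hm1 j
    · intro a ha b hb
      obtain ⟨j, rfl⟩ := (List.mem_ofFn' _ _).1 (List.mem_reverse.1 hb)
      rw [List.mem_append] at ha
      rcases ha with ha | ha
      · obtain ⟨i, rfl⟩ := (List.mem_ofFn' _ _).1 ha
        by_cases hij : i = j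
        · subst hij; exact hmi i
        · exact (hμ i j hij).2
      · simp only [List.mem_cons, List.not_mem_nil, or_false] at ha
        rcases ha with rfl | rfl
        · intro h; change _ = (μ j)⁻¹ at h; exact hm2 j (by rw [← inv_inv (μ j), ← h]; norm_num)
        · intro h; change _ = (μ j)⁻¹ at h; exact hm1 j (by rw [← inv_inv (μ j), ← h]; norm_num)
  · simp only [List.length_append, List.length_ofFn, List.length_reverse, List.length_cons,
      List.length_nil]
    omega
  · simp only [dlist, List.length_append, List.length_reverse, List.length_flatten, List.map_ofFn,
      List.length_replicate, List.sum_ofFn, Function.comp_apply]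
    omega
  · intro a ha
    rcases hdmem a ha with ⟨j, rfl⟩ | rfl | rfl | ⟨j, rfl⟩
    · exact hμ0 j
    · norm_num
    · norm_num
    · exact inv_ne_zero (hμ0 j)
  · intro a ha
    exact (hLmem a).2 (hdmem a ha)
  · have h1 : ((List.ofFn fun j : Fin ℓ => List.replicate (nn j) (μ j)).flatten).map
        (fun a => a⁻¹) = (List.ofFn fun j : Fin ℓ => List.replicate (nn j) (μ j)⁻¹).flatten := by
      rw [List.map_flatten, List.map_ofFn]
      congr 2
      funext j
      simp
    have h2 : ((List.ofFn fun j : Fin ℓ => List.replicate (nn j) (μ j)⁻¹).flatten).map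
        (fun a => a⁻¹) = (List.ofFn fun j : Fin ℓ => List.replicate (nn j) (μ j)).flatten := by
      rw [List.map_flatten, List.map_ofFn]
      congr 2
      funext j
      simp
    simp only [dlist, List.reverse_append, List.map_append, List.reverse_reverse, List.map_reverse,
      h1, h2, List.reverse_replicate, List.map_replicate, List.append_assoc, inv_one, inv_neg]
  · intro r
    simp only [dlist, List.map_append, List.map_reverse, List.sum_append, List.sum_reverse,
      List.map_flatten, List.map_ofFn, List.sum_flatten, List.sum_ofFn, List.map_replicate,
      List.sum_replicate, Function.comp_apply, nsmul_eq_mul, one_pow, mul_add,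
      Finset.sum_add_distrib]
    push_cast
    ring
end

section
/- Let k be a field and q ∈ k a nonzero scalar with q⁴ ≠ 1. Let A be an associative k-algebra containing elements f_1, …, f_N satisfying the q-Serre relations of type A: f_a f_b = f_b f_a whenever |a−b| ≥ 2, and f_a² f_b − (q + q⁻¹) f_a f_b f_a + f_b f_a² = 0 whenever |a−b| = 1. For 1 ≤ i < j ≤ N set f_μ := [f_i, [f_{i+1}, …, [f_{j−1}, f_j]_q …]_q]_q (iterated q-commutators, innermost [f_{j−1},f_j]_q), where [u,v]_t := uv − t·vu. Then the 'higher order Serre relations' hold: f_i f_μ = q⁻¹ f_μ f_i and f_j f_μ = q f_μ f_j. -/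
/-- The deformed commutator `[u,v]_t = u·v − t·v·u`. -/
def qComm {k A : Type*} [CommRing k] [Ring A] [Algebra k A] (t : k) (u v : A) : A :=
  u * v - t • (v * u)

/-- The iterated deformed commutator
`f_μ = [f i, [f (i+1), …, [f (j−1), f j]_t …]_t]_t` (innermost `[f (j−1), f j]_t`). -/
def iterQComm {k A : Type*} [CommRing k] [Ring A] [Algebra k A]
    (t : k) (f : ℕ → A) (i j : ℕ) : A :=
  (List.range' i (j - i)).foldr (fun a acc => qComm t (f a) acc) (f j)

theorem iterQ_self {k A : Type*} [CommRing k] [Ring A] [Algebra k A]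
    (t : k) (f : ℕ → A) (j : ℕ) : iterQComm t f j j = f j := by
  simp [iterQComm]

theorem iterQ_step {k A : Type*} [CommRing k] [Ring A] [Algebra k A]
    (t : k) (f : ℕ → A) (i j : ℕ) (h : i < j) :
    iterQComm t f i j = f i * iterQComm t f (i + 1) j - t • (iterQComm t f (i + 1) j * f i) := by
  obtain ⟨d, rfl⟩ := Nat.exists_eq_add_of_lt h
  have h1 : i + d + 1 - i = d + 1 := by omega
  have h2 : i + d + 1 - (i + 1) = d := by omega
  simp only [iterQComm, h1, h2, List.range'_succ, List.foldr_cons, qComm]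

theorem iterQ_commute {k A : Type*} [CommRing k] [Ring A] [Algebra k A]
    (t : k) (f : ℕ → A) (x : A) (j d : ℕ) : ∀ i, i + d = j →
    (∀ a, i ≤ a → a ≤ j → Commute x (f a)) → Commute x (iterQComm t f i j) := by
  induction d with
  | zero =>
    intro i h H
    obtain rfl : i = j := by omega
    rw [iterQ_self]
    exact H _ le_rfl le_rfl
  | succ d ih =>
    intro i h H
    rw [iterQ_step t f i j (by omega)]
    have h1 := ih (i + 1) (by omega) (fun a ha hb => H a (by omega) hb)
    have h2 := H i le_rfl (by omega)
    exact (h2.mul_right h1).sub_right ((h1.mul_right h2).smul_right t)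

theorem serre_lift {k A : Type*} [CommRing k] [Ring A] [Algebra k A]
    (t c : k) (x b y : A) (hy : Commute x y)
    (h : x ^ 2 * b - c • (x * b * x) + b * x ^ 2 = 0) :
    x ^ 2 * (b * y - t • (y * b)) - c • (x * (b * y - t • (y * b)) * x)
      + (b * y - t • (y * b)) * x ^ 2 = 0 := by
  have hy2 : Commute (x ^ 2) y := hy.pow_left 2
  have e1 : x ^ 2 * (b * y) - c • (x * (b * y) * x) + b * y * x ^ 2 = 0 := by
    have : x ^ 2 * (b * y) - c • (x * (b * y) * x) + b * y * x ^ 2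
        = (x ^ 2 * b - c • (x * b * x) + b * x ^ 2) * y := by
      simp only [add_mul, sub_mul, smul_mul_assoc, mul_assoc, hy.eq, hy2.eq]
    rw [this, h, zero_mul]
  have e2 : x ^ 2 * (y * b) - c • (x * (y * b) * x) + y * b * x ^ 2 = 0 := by
    have : x ^ 2 * (y * b) - c • (x * (y * b) * x) + y * b * x ^ 2
        = y * (x ^ 2 * b - c • (x * b * x) + b * x ^ 2) := by
      simp only [mul_add, mul_sub, mul_smul_comm, ← mul_assoc, hy.eq, hy2.eq]
    rw [this, h, mul_zero]
  have : x ^ 2 * (b * y - t • (y * b)) - c • (x * (b * y - t • (y * b)) * x)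
      + (b * y - t • (y * b)) * x ^ 2
      = (x ^ 2 * (b * y) - c • (x * (b * y) * x) + b * y * x ^ 2)
        - t • (x ^ 2 * (y * b) - c • (x * (y * b) * x) + y * b * x ^ 2) := by
    simp only [mul_sub, sub_mul, mul_smul_comm, smul_mul_assoc, smul_sub, smul_add,
      smul_comm c t]
    abel
  rw [this, e1, e2, smul_zero, sub_zero]

theorem serre_left {k A : Type*} [Field k] [Ring A] [Algebra k A]
    (q : k) (hq0 : q ≠ 0) (x b : A)
    (h : x ^ 2 * b - (q + q⁻¹) • (x * b * x) + b * x ^ 2 = 0) :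
    x * (x * b - q • (b * x)) = q⁻¹ • ((x * b - q • (b * x)) * x) := by
  rw [← sub_eq_zero, ← h]
  simp only [mul_sub, sub_mul, mul_smul_comm, smul_mul_assoc, smul_sub, add_smul, smul_smul,
    inv_mul_cancel₀ hq0, one_smul, pow_two, mul_assoc]
  abel

theorem serre_right {k A : Type*} [Field k] [Ring A] [Algebra k A]
    (q : k) (hq0 : q ≠ 0) (x b : A)
    (h : b ^ 2 * x - (q + q⁻¹) • (b * x * b) + x * b ^ 2 = 0) :
    b * (x * b - q • (b * x)) = q • ((x * b - q • (b * x)) * b) := by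
  have h' : -(q • (b ^ 2 * x - (q + q⁻¹) • (b * x * b) + x * b ^ 2)) = 0 := by
    rw [h, smul_zero, neg_zero]
  rw [← sub_eq_zero, ← h']
  simp only [mul_sub, sub_mul, mul_smul_comm, smul_mul_assoc, smul_sub, smul_add, add_smul,
    smul_smul, mul_inv_cancel₀ hq0, one_smul, pow_two, mul_assoc]
  abel

/-- higher order Serre relations:
`f_i f_μ = q⁻¹ f_μ f_i` and `f_j f_μ = q f_μ f_j`. -/
theorem higher_order_serre_relations
    {k A : Type*} [Field k] [Ring A] [Algebra k A]
    (q : k) (hq0 : q ≠ 0) (hq4 : q ^ 4 ≠ 1)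
    (N : ℕ) (f : ℕ → A)
    (hcomm : ∀ a b, 1 ≤ a → a ≤ N → 1 ≤ b → b ≤ N → (a + 2 ≤ b ∨ b + 2 ≤ a) →
      f a * f b = f b * f a)
    (hserre : ∀ a b, 1 ≤ a → a ≤ N → 1 ≤ b → b ≤ N → (b = a + 1 ∨ a = b + 1) →
      f a ^ 2 * f b - (q + q⁻¹) • (f a * f b * f a) + f b * f a ^ 2 = 0)
    (i j : ℕ) (hi : 1 ≤ i) (hij : i < j) (hj : j ≤ N) :
    f i * iterQComm q f i j = q⁻¹ • (iterQComm q f i j * f i) ∧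
    f j * iterQComm q f i j = q • (iterQComm q f i j * f j) := by
  constructor
  · rw [iterQ_step q f i j hij]
    apply serre_left q hq0
    rcases Nat.lt_or_ge (i + 1) j with h | h
    · rw [iterQ_step q f (i + 1) j h]
      apply serre_lift
      · exact iterQ_commute q f (f i) j (j - (i + 1 + 1)) _ (by omega)
          (fun a ha hb => hcomm i a hi (by omega) (by omega) (by omega) (by omega))
      · exact hserre i (i + 1) hi (by omega) (by omega) (by omega) (by omega)
    · obtain rfl : j = i + 1 := by omega
      rw [iterQ_self]
      exact hserre i (i + 1) hi (by omega) (by omega) (by omega) (by omega)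
  · obtain ⟨d, rfl⟩ := Nat.exists_eq_add_of_lt hij
    induction d generalizing i with
    | zero =>
      rw [iterQ_step q f i _ (by omega), Nat.add_zero, iterQ_self]
      apply serre_right q hq0
      exact hserre (i + 1) i (by omega) (by omega) (by omega) (by omega) (by omega)
    | succ d ih =>
      have h1 := ih (i + 1) (by omega) (by omega) (by omega)
      rw [show i + 1 + d + 1 = i + (d + 1) + 1 by omega] at h1
      rw [iterQ_step q f i _ (by omega)]
      have h2 := hcomm (i + (d + 1) + 1) i (by omega) (by omega) (by omega) (by omega) (by omega)
      generalize iterQComm q f (i + 1) (i + (d + 1) + 1) = X at *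
      generalize f (i + (d + 1) + 1) = y at *
      rw [mul_sub, mul_smul_comm, ← mul_assoc, h2, mul_assoc, h1, ← mul_assoc y, h1]
      simp only [sub_mul, mul_smul_comm, smul_mul_assoc, smul_sub, mul_assoc, h2]
end

section
/- Let k be a field and q ∈ k a nonzero scalar with q⁴ ≠ 1. Let A be an associative k-algebra containing elements f_1, …, f_N satisfying the q-Serre relations of type A: f_a f_b = f_b f_a whenever |a−b| ≥ 2, and f_a² f_b − (q + q⁻¹) f_a f_b f_a + f_b f_a² = 0 whenever |a−b| = 1. For 1 ≤ i < j ≤ N set f_μ := [f_i, [f_{i+1}, …, [f_{j−1}, f_j]_q …]_q]_q and f̃_μ := [f_i, [f_{i+1}, …, [f_{j−1}, f_j]_{q⁻¹} …]_{q⁻¹}]_{q⁻¹}, where [u,v]_t := uv − t·vu. Suppose g ∈ A is a finite product (word) of elements from the set {f_i, f_{i+1}, …, f_j} in which f_i occurs at most once and f_j occurs at most once. Then: (1) if g contains both f_i and f_j, or neither of them, then [g, f_μ] = 0 (ordinary commutator); (2) if g contains f_i but not f_j, then [g, f_μ]_{q⁻¹} = 0; (3) if g contains f_j but not f_i, then [g,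 f_μ]_q = 0. In particular, [f̃_μ, f_μ] = 0, [f̃_{μ'}, f_μ]_q = 0 and [f̃_{μ''}, f_μ]_{q⁻¹} = 0, where f̃_{μ'} and f̃_{μ''} are defined as f̃_μ but with the generator range i+1,…,j and i,…,j−1 respectively. -/
section helpers

variable {k A : Type*} [Field k] [Ring A] [Algebra k A]

theorem qc_mid (q : k) (hq0 : q ≠ 0) (hs : q + q⁻¹ ≠ 0) (x y z : A) (hxz : x * z = z * x)
    (hx : y ^ 2 * x - (q + q⁻¹) • (y * x * y) + x * y ^ 2 = 0)
    (hz : y ^ 2 * z - (q + q⁻¹) • (y * z * y) + z * y ^ 2 = 0) :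
    y * qComm q x (qComm q y z) = qComm q x (qComm q y z) * y := by
  have h1 := congrArg (fun t => t * z) hx
  have h2 := congrArg (fun t => t * x) hz
  have h3 := congrArg (fun t => z * t) hx
  have h4 := congrArg (fun t => x * t) hz
  have e1 : ∀ w, z * (x * w) = x * (z * w) := fun w => by
    rw [← mul_assoc, ← hxz, mul_assoc]
  have e0 := hxz.symm
  simp only [pow_two, mul_add, add_mul, mul_sub, sub_mul, smul_mul_assoc, mul_smul_comm,
    mul_assoc, mul_zero, zero_mul, e0, e1] at h1 h2 h3 h4
  rw [← sub_eq_zero]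
  refine (smul_eq_zero_iff_right hs).1 ?_
  simp only [qComm, mul_sub, sub_mul, smul_mul_assoc, mul_smul_comm, mul_assoc, e0, e1]
  linear_combination (norm := skip) (-1 : k) • h1 - q ^ 2 • h2 + q ^ 2 • h3 + (1 : k) • h4
  match_scalars <;> field_simp <;> ring

theorem qc_left (q : k) (hq0 : q ≠ 0) (y z : A)
    (hz : y ^ 2 * z - (q + q⁻¹) • (y * z * y) + z * y ^ 2 = 0) :
    y * qComm q y z = q⁻¹ • (qComm q y z * y) := by
  simp only [pow_two, mul_assoc] at hz
  simp only [qComm, mul_sub, sub_mul, smul_mul_assoc, mul_smul_comm, mul_assoc]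
  linear_combination (norm := skip) (1 : k) • hz
  match_scalars <;> field_simp <;> ring

theorem qc_right (q : k) (hq0 : q ≠ 0) (y x : A)
    (hx : y ^ 2 * x - (q + q⁻¹) • (y * x * y) + x * y ^ 2 = 0) :
    y * qComm q x y = q • (qComm q x y * y) := by
  simp only [pow_two, mul_assoc] at hx
  simp only [qComm, mul_sub, sub_mul, smul_mul_assoc, mul_smul_comm, mul_assoc]
  linear_combination (norm := skip) (-q) • hx
  match_scalars <;> field_simp <;> ring

theorem qc_assoc (q : k) (x y z : A) (hxz : x * z = z * x) :
    qComm q x (qComm q y z) = qComm q (qComm q x y) z := by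
  have e1 : ∀ w, z * (x * w) = x * (z * w) := fun w => by
    rw [← mul_assoc, ← hxz, mul_assoc]
  have e0 := hxz.symm
  simp only [qComm, mul_sub, sub_mul, smul_mul_assoc, mul_smul_comm, mul_assoc, e0, e1]
  module

theorem qc_commute (q : k) {x y z : A} (hx : x * y = y * x) (hz : x * z = z * x) :
    x * qComm q y z = qComm q y z * x := by
  have h1 : Commute x y := hx
  have h2 : Commute x z := hz
  exact ((h1.mul_right h2).sub_right ((h2.mul_right h1).smul_right q))

theorem qc_scale (t c d : k) {u v F : A} (hu : u * F = c • (F * u)) (hv : v * F = d • (F * v)) :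
    qComm t u v * F = (c * d) • (F * qComm t u v) := by
  have h1 : u * (v * F) = (c * d) • (F * (u * v)) := by
    rw [hv, mul_smul_comm, ← mul_assoc, hu, smul_mul_assoc, smul_smul, mul_assoc, mul_comm]
  have h2 : v * (u * F) = (c * d) • (F * (v * u)) := by
    rw [hu, mul_smul_comm, ← mul_assoc, hv, smul_mul_assoc, smul_smul, mul_assoc]
  simp only [qComm, sub_mul, smul_mul_assoc, mul_assoc, h1, h2, mul_sub, mul_smul_comm]
  module

/-- Serre is preserved by commutators with commuting elements (right factor good). -/
theorem serre_r (q s : k) {y u v : A} (hu : y * u = u * y)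
    (hv : y ^ 2 * v - s • (y * v * y) + v * y ^ 2 = 0) :
    y ^ 2 * qComm q u v - s • (y * qComm q u v * y) + qComm q u v * y ^ 2 = 0 := by
  have h1 := congrArg (fun t => u * t) hv
  have h2 := congrArg (fun t => t * u) hv
  have e1 : ∀ w, y * (u * w) = u * (y * w) := fun w => by
    rw [← mul_assoc, hu, mul_assoc]
  simp only [pow_two, mul_add, add_mul, mul_sub, sub_mul, smul_mul_assoc, mul_smul_comm,
    mul_assoc, mul_zero, zero_mul, hu, e1] at h1 h2
  simp only [qComm, pow_two, mul_sub, sub_mul, smul_mul_assoc, mul_smul_comm, mul_assoc, hu, e1]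
  linear_combination (norm := module) (1 : k) • h1 - q • h2

theorem serre_l (q s : k) {y u v : A} (hu : y * u = u * y)
    (hv : y ^ 2 * v - s • (y * v * y) + v * y ^ 2 = 0) :
    y ^ 2 * qComm q v u - s • (y * qComm q v u * y) + qComm q v u * y ^ 2 = 0 := by
  have h1 := congrArg (fun t => u * t) hv
  have h2 := congrArg (fun t => t * u) hv
  have e1 : ∀ w, y * (u * w) = u * (y * w) := fun w => by
    rw [← mul_assoc, hu, mul_assoc]
  simp only [pow_two, mul_add, add_mul, mul_sub, sub_mul, smul_mul_assoc, mul_smul_comm,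
    mul_assoc, mul_zero, zero_mul, hu, e1] at h1 h2
  simp only [qComm, pow_two, mul_sub, sub_mul, smul_mul_assoc, mul_smul_comm, mul_assoc, hu, e1]
  linear_combination (norm := module) (1 : k) • h2 - q • h1

theorem iter_self (t : k) (f : ℕ → A) (i : ℕ) : iterQComm t f i i = f i := by
  simp [iterQComm]

theorem iter_succ (t : k) (f : ℕ → A) {i j : ℕ} (h : i < j) :
    iterQComm t f i j = qComm t (f i) (iterQComm t f (i + 1) j) := by
  obtain ⟨n, rfl⟩ := Nat.exists_eq_add_of_lt h
  have e1 : i + n + 1 - i = n + 1 := by omega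
  have e2 : i + n + 1 - (i + 1) = n := by omega
  simp [iterQComm, e1, e2, List.range'_succ]

/-- Downward induction principle for the iterated commutator. -/
theorem iter_ind (t : k) (f : ℕ → A) (P : ℕ → A → Prop) (j : ℕ) (m : ℕ) (hm : m ≤ j)
    (h0 : P j (f j))
    (hs : ∀ a, m ≤ a → a < j → P (a + 1) (iterQComm t f (a + 1) j) →
      P a (qComm t (f a) (iterQComm t f (a + 1) j))) : P m (iterQComm t f m j) := by
  induction hm using Nat.decreasingInduction with
  | self => rw [iter_self]; exact h0
  | of_succ a ha ih =>
    rw [iter_succ t f ha]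
    exact hs a le_rfl ha (ih fun b hb hbj => hs b (by omega) hbj)

theorem iter_commute (t : k) (f : ℕ → A) (x : A) {m j : ℕ} (hm : m ≤ j)
    (h : ∀ a, m ≤ a → a ≤ j → x * f a = f a * x) :
    x * iterQComm t f m j = iterQComm t f m j * x := by
  refine iter_ind t f (fun _ F => x * F = F * x) j m hm (h j hm le_rfl) ?_
  intro a h1 h2 ih
  exact qc_commute t (h a h1 h2.le) ih

theorem iter_scale (t c : k) (f : ℕ → A) (F : A) {m j : ℕ} (hm : m ≤ j)
    (h : ∀ a, m ≤ a → a < j → f a * F = F * f a) (hj : f j * F = c • (F * f j)) :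
    iterQComm t f m j * F = c • (F * iterQComm t f m j) := by
  refine iter_ind t f (fun _ G => G * F = c • (F * G)) j m hm hj ?_
  intro a h1 h2 ih
  have := qc_scale t 1 c (u := f a) (F := F) (by rw [one_smul]; exact h a h1 h2) ih
  rwa [one_mul] at this

theorem iter_split (t : k) (f : ℕ → A) {i m j : ℕ} (him : i ≤ m) (hmj : m < j)
    (hc : ∀ a b, i ≤ a → a < m → m < b → b ≤ j → f a * f b = f b * f a) :
    iterQComm t f i j = qComm t (iterQComm t f i m) (iterQComm t f (m + 1) j) := by
  refine iter_ind t f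
    (fun a G => iterQComm t f a j = qComm t G (iterQComm t f (m + 1) j)) m i him
    (iter_succ t f hmj) ?_
  intro a h1 h2 ih
  rw [iter_succ t f (h2.trans hmj), ih]
  apply qc_assoc
  exact iter_commute t f (f a) hmj fun b hb hbj => hc a b h1 h2 hb hbj

end helpers

/-- commutation of words with the root vector `f_μ`.  A word `g` in
`f_i, …, f_j` containing `f_i` and `f_j` at most once satisfies:
(1) `[g, f_μ] = 0` if it contains both or none of `f_i, f_j`;
(2) `[g, f_μ]_{q⁻¹} = 0` if it contains only `f_i`;
(3) `[g, f_μ]_q = 0` if it contains only `f_j`.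
In particular `[f̃_μ, f_μ] = 0`, `[f̃_{μ'}, f_μ]_q = 0`, `[f̃_{μ''}, f_μ]_{q⁻¹} = 0`. -/
theorem word_commutation_with_root_vector
    {k A : Type*} [Field k] [Ring A] [Algebra k A]
    (q : k) (hq0 : q ≠ 0) (hq4 : q ^ 4 ≠ 1)
    (N : ℕ) (f : ℕ → A)
    (hcomm : ∀ a b, 1 ≤ a → a ≤ N → 1 ≤ b → b ≤ N → (a + 2 ≤ b ∨ b + 2 ≤ a) →
      f a * f b = f b * f a)
    (hserre : ∀ a b, 1 ≤ a → a ≤ N → 1 ≤ b → b ≤ N → (b = a + 1 ∨ a = b + 1) →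
      f a ^ 2 * f b - (q + q⁻¹) • (f a * f b * f a) + f b * f a ^ 2 = 0)
    (i j : ℕ) (hi : 1 ≤ i) (hij : i < j) (hj : j ≤ N) :
    (∀ w : List ℕ, (∀ a ∈ w, i ≤ a ∧ a ≤ j) → w.count i ≤ 1 → w.count j ≤ 1 →
      (((i ∈ w ∧ j ∈ w) ∨ (i ∉ w ∧ j ∉ w)) →
        (w.map f).prod * iterQComm q f i j = iterQComm q f i j * (w.map f).prod) ∧
      ((i ∈ w ∧ j ∉ w) →
        (w.map f).prod * iterQComm q f i j
          = q⁻¹ • (iterQComm q f i j * (w.map f).prod)) ∧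
      ((j ∈ w ∧ i ∉ w) →
        (w.map f).prod * iterQComm q f i j
          = q • (iterQComm q f i j * (w.map f).prod))) ∧
    iterQComm q⁻¹ f i j * iterQComm q f i j = iterQComm q f i j * iterQComm q⁻¹ f i j ∧
    iterQComm q⁻¹ f (i + 1) j * iterQComm q f i j
      = q • (iterQComm q f i j * iterQComm q⁻¹ f (i + 1) j) ∧
    iterQComm q⁻¹ f i (j - 1) * iterQComm q f i j
      = q⁻¹ • (iterQComm q f i j * iterQComm q⁻¹ f i (j - 1)) := by
  have hs : q + q⁻¹ ≠ 0 := by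
    intro h
    apply hq4
    have h2 : q ^ 2 = -1 := by
      field_simp at h
      linear_combination h
    linear_combination (q ^ 2 - 1) * h2
  -- Serre relation of `f (b+1)` with the block `i..b`
  have hSx : ∀ b, i ≤ b → b < j →
      f (b + 1) ^ 2 * iterQComm q f i b - (q + q⁻¹) • (f (b + 1) * iterQComm q f i b * f (b + 1))
        + iterQComm q f i b * f (b + 1) ^ 2 = 0 := by
    intro b hb hbj
    refine iter_ind q f (fun _ G => f (b + 1) ^ 2 * G - (q + q⁻¹) • (f (b + 1) * G * f (b + 1))
        + G * f (b + 1) ^ 2 = 0) b i hb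
      (hserre _ _ (by omega) (by omega) (by omega) (by omega) (by omega)) ?_
    intro a h1 h2 ih
    exact serre_r q _ (hcomm _ _ (by omega) (by omega) (by omega) (by omega) (by omega)) ih
  -- Serre relation of `f a` with the block `a+1..j`
  have hSz : ∀ a, i ≤ a → a < j →
      f a ^ 2 * iterQComm q f (a + 1) j - (q + q⁻¹) • (f a * iterQComm q f (a + 1) j * f a)
        + iterQComm q f (a + 1) j * f a ^ 2 = 0 := by
    intro a ha haj
    rcases Nat.lt_or_ge (a + 1) j with h | h
    · rw [iter_succ q f h]
      refine serre_l q _ ?_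
        (hserre _ _ (by omega) (by omega) (by omega) (by omega) (by omega))
      exact iter_commute q f (f a) h fun b hb hbj =>
        hcomm _ _ (by omega) (by omega) (by omega) (by omega) (by omega)
    · have : j = a + 1 := by omega
      subst this
      rw [iter_self]
      exact hserre _ _ (by omega) (by omega) (by omega) (by omega) (by omega)
  have hFi : f i * iterQComm q f i j = q⁻¹ • (iterQComm q f i j * f i) := by
    rw [iter_succ q f hij]
    exact qc_left q hq0 _ _ (hSz i le_rfl hij)
  have hFj : f j * iterQComm q f i j = q • (iterQComm q f i j * f j) := by
    obtain ⟨b, rfl⟩ : ∃ b, j = b + 1 := ⟨j - 1, by omega⟩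
    rw [iter_split q f (m := b) (by omega) (by omega) (fun a c h1 h2 h3 h4 =>
      hcomm _ _ (by omega) (by omega) (by omega) (by omega) (by omega)), iter_self]
    exact qc_right q hq0 _ _ (hSx b (by omega) (by omega))
  have hFa : ∀ a, i < a → a < j → f a * iterQComm q f i j = iterQComm q f i j * f a := by
    intro a h1 h2
    obtain ⟨b, rfl⟩ : ∃ b, a = b + 1 := ⟨a - 1, by omega⟩
    rw [iter_split q f (m := b) (by omega) (by omega) (fun a c h1 h2 h3 h4 =>
      hcomm _ _ (by omega) (by omega) (by omega) (by omega) (by omega)), iter_succ q f h2]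
    refine qc_mid q hq0 hs _ _ _ ?_ (hSx b (by omega) (by omega)) (hSz _ (by omega) h2)
    refine iter_commute q f _ h2 fun c hc hcj => ?_
    refine (iter_commute q f (f c) (by omega) fun d hd hdb => ?_).symm
    exact hcomm _ _ (by omega) (by omega) (by omega) (by omega) (by omega)
  generalize hF : iterQComm q f i j = F at *
  have hw : ∀ w : List ℕ, (∀ a ∈ w, i ≤ a ∧ a ≤ j) →
      (w.map f).prod * F = (q⁻¹ ^ w.count i * q ^ w.count j) • (F * (w.map f).prod) := by
    intro w
    induction w with
    | nil => intro _; simp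
    | cons a w ih =>
      intro h
      have ih := ih fun b hb => h b (List.mem_cons_of_mem _ hb)
      have ha := h a List.mem_cons_self
      rw [List.map_cons, List.prod_cons, mul_assoc, ih, mul_smul_comm, ← mul_assoc]
      rcases Nat.lt_or_ge i a with h1 | h1
      · rcases Nat.lt_or_ge a j with h2 | h2
        · rw [hFa a h1 h2, List.count_cons_of_ne (by omega), List.count_cons_of_ne (by omega),
            mul_assoc]
        · obtain rfl : a = j := by omega
          rw [hFj, List.count_cons_of_ne (by omega), List.count_cons_self, smul_mul_assoc,
            smul_smul, mul_assoc, pow_succ, mul_assoc]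
      · obtain rfl : a = i := by omega
        rw [hFi, List.count_cons_of_ne (b := a) (a := j) (by omega), List.count_cons_self,
          smul_mul_assoc, smul_smul, pow_succ, mul_right_comm, mul_assoc F]
  have hR : iterQComm q⁻¹ f (i + 1) j * F = q • (F * iterQComm q⁻¹ f (i + 1) j) :=
    iter_scale q⁻¹ q f F hij (fun a h1 h2 => hFa a h1 h2) hFj
  refine ⟨?_, ?_, hR, ?_⟩
  · intro w h hci hcj
    have key := hw w h
    have one : ∀ a, w.count a ≤ 1 → a ∈ w → w.count a = 1 := fun a h1 h2 =>
      le_antisymm h1 (List.count_pos_iff.2 h2)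
    refine ⟨?_, ?_, ?_⟩
    · rintro (⟨h1, h2⟩ | ⟨h1, h2⟩)
      · rw [key, one i hci h1, one j hcj h2, pow_one, pow_one, inv_mul_cancel₀ hq0, one_smul]
      · rw [key, List.count_eq_zero_of_not_mem h1, List.count_eq_zero_of_not_mem h2]; simp
    · rintro ⟨h1, h2⟩
      rw [key, one i hci h1, List.count_eq_zero_of_not_mem h2]; simp
    · rintro ⟨h1, h2⟩
      rw [key, one j hcj h1, List.count_eq_zero_of_not_mem h2]; simp
  · have := qc_scale q⁻¹ _ _ hFi hR
    rwa [inv_mul_cancel₀ hq0, one_smul, ← iter_succ q⁻¹ f hij] at this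
  · rcases Nat.lt_or_ge i (j - 1) with h | h
    · rw [iter_succ q⁻¹ f h]
      have h2 : iterQComm q⁻¹ f (i + 1) (j - 1) * F =
          (1 : k) • (F * iterQComm q⁻¹ f (i + 1) (j - 1)) :=
        iter_scale q⁻¹ 1 f F h (fun a h1 h2 => hFa a h1 (by omega))
          (by rw [one_smul]; exact hFa _ h (by omega))
      have := qc_scale q⁻¹ _ _ hFi h2
      rwa [mul_one] at this
    · have : j - 1 = i := by omega
      rw [this, iter_self]
      exact hFi
end

section
/- Let k be a field and q ∈ k a nonzero scalar with q⁴ ≠ 1. Let A be an associative k-algebra containing elements f_1, …, f_p, f_β (p ≥ 1) satisfying the q-Serre relations of the negative Chevalley generators of U_q(sp(2p+2)): f_a f_b = f_b f_a for |a−b| ≥ 2; f_β f_a = f_a f_β for 1 ≤ a ≤ p−1; f_a² f_b − (q+q⁻¹) f_a f_b f_a + f_b f_a² = 0 for |a−b| = 1 with 1 ≤ a,b ≤ p; f_β² f_p − (q²+q⁻²) f_β f_p f_β + f_p f_β² = 0; and f_p³ f_β − (q²+1+q⁻²) f_p² f_β f_p + (q²+1+q⁻²) f_p f_β f_p² − f_β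 f_p³ = 0. Let M be a left A-module and v ∈ M a vector with f_a v = 0 for a = 2,…,p and f_β v = 0. Write f_{p+1} := f_β. Then for all integers i, k with 1 ≤ i ≤ p, 2 ≤ k ≤ p+1 and k ≠ i+1, one has f_k · (f_i f_{i−1} ⋯ f_2 f_1 · v) = 0. -/
lemma serre_aux1 {k A M : Type*} [Field k] [Ring A] [Algebra k A]
    [AddCommGroup M] [Module A M] (c : k) (x y : A) (u : M)
    (h : x ^ 2 * y - c • (x * y * x) + y * x ^ 2 = 0) (hx : x • u = 0) :
    x • x • y • u = 0 := by
  have h1 : x * x * y = (algebraMap k A c * (x * y) - y * x) * x := by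
    rw [Algebra.smul_def] at h
    have h2 : x * x * y - (algebraMap k A c * (x * y) - y * x) * x = 0 := by
      rw [← h]; noncomm_ring
    exact sub_eq_zero.mp h2
  rw [← mul_smul, ← mul_smul, h1, mul_smul, hx, smul_zero]

lemma serre_aux2 {k A M : Type*} [Field k] [Ring A] [Algebra k A]
    [AddCommGroup M] [Module A M] (c : k) (hc : c ≠ 0) (x y : A) (u : M)
    (h : x ^ 2 * y - c • (x * y * x) + y * x ^ 2 = 0) (hy : y • u = 0)
    (hx : x • x • u = 0) :
    x • y • x • u = 0 := by
  have h1 : c • (x * y * x) = x * x * y + y * (x * x) := by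
    have h2 : x * x * y + y * (x * x) - c • (x * y * x) = 0 := by
      rw [← h, pow_two]; abel
    exact (sub_eq_zero.mp h2).symm
  have h3 : x * y * x = algebraMap k A c⁻¹ * (x * x * y + y * (x * x)) := by
    rw [← h1, ← Algebra.smul_def, smul_smul, inv_mul_cancel₀ hc, one_smul]
  rw [← mul_smul, ← mul_smul, h3, mul_smul, add_smul, mul_smul (x * x) y, hy,
    mul_smul y, mul_smul x x u, hx]
  simp

/-- in a module over an algebra whose elements `f_1,…,f_p,f_β` satisfy the
q-Serre relations of the negative Chevalley generators of `U_q(sp(2p+2))`, with `v`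
killed by `f_2,…,f_p` and `f_β`, one has `f_k·(f_i f_{i−1} ⋯ f_1·v) = 0` for
`2 ≤ k ≤ p+1`, `k ≠ i+1` (where `f_{p+1} := f_β`). -/
theorem fk_kills_descending_monomial
    {k A M : Type*} [Field k] [Ring A] [Algebra k A]
    [AddCommGroup M] [Module A M]
    (q : k) (hq0 : q ≠ 0) (hq4 : q ^ 4 ≠ 1)
    (p : ℕ) (hp : 1 ≤ p) (f : ℕ → A) (fβ : A)
    (hcomm : ∀ a b, 1 ≤ a → a ≤ p → 1 ≤ b → b ≤ p → (a + 2 ≤ b ∨ b + 2 ≤ a) →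
      f a * f b = f b * f a)
    (hβcomm : ∀ a, 1 ≤ a → a + 1 ≤ p → fβ * f a = f a * fβ)
    (hserre : ∀ a b, 1 ≤ a → a ≤ p → 1 ≤ b → b ≤ p → (b = a + 1 ∨ a = b + 1) →
      f a ^ 2 * f b - (q + q⁻¹) • (f a * f b * f a) + f b * f a ^ 2 = 0)
    (hββ : fβ ^ 2 * f p - (q ^ 2 + (q ^ 2)⁻¹) • (fβ * f p * fβ) + f p * fβ ^ 2 = 0)
    (hppβ : f p ^ 3 * fβ - (q ^ 2 + 1 + (q ^ 2)⁻¹) • (f p ^ 2 * fβ * f p)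
      + (q ^ 2 + 1 + (q ^ 2)⁻¹) • (f p * fβ * f p ^ 2) - fβ * f p ^ 3 = 0)
    (v : M)
    (hfv : ∀ a, 2 ≤ a → a ≤ p → f a • v = 0) (hβv : fβ • v = 0) :
    ∀ i m, 1 ≤ i → i ≤ p → 2 ≤ m → m ≤ p + 1 → m ≠ i + 1 →
      ((if m = p + 1 then fβ else f m) * ((List.range' 1 i).reverse.map f).prod) • v = 0 := by
  have hc : q + q⁻¹ ≠ 0 := by
    intro h
    apply hq4
    have h2 : q ^ 2 + 1 = 0 := by
      have : q ^ 2 + 1 = q * (q + q⁻¹) := by field_simp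
      rw [this, h, mul_zero]
    linear_combination (q ^ 2 - 1) * h2
  set w : ℕ → M := fun i => ((List.range' 1 i).reverse.map f).prod • v with hw
  set g : ℕ → A := fun m => if m = p + 1 then fβ else f m with hg
  have w0 : w 0 = v := by simp [hw]
  have ws : ∀ i, w (i + 1) = f (i + 1) • w i := by
    intro i
    simp [hw, List.range'_concat, mul_smul, add_comm]
  have gf : ∀ m, m ≤ p → g m = f m := by
    intro m hm
    simp [hg, show m ≠ p + 1 by omega]
  have key : ∀ i, i ≤ p → ∀ m, 2 ≤ m → m ≤ p + 1 → m ≠ i + 1 → g m • w i = 0 := by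
    intro i
    induction i using Nat.strong_induction_on with
    | _ i ih =>
    intro hi m hm2 hmp hmi
    have comm : ∀ j, i = j + 1 → (i + 2 ≤ m ∨ m + 2 ≤ i) → g m • w i = 0 := by
      intro j hj hor
      subst hj
      have hcm : g m * f (j + 1) = f (j + 1) * g m := by
        by_cases h : m = p + 1
        · have : g m = fβ := by simp [hg, h]
          rw [this]
          exact hβcomm _ (by omega) (by omega)
        · rw [gf m (by omega)]
          exact hcomm _ _ (by omega) (by omega) (by omega) (by omega) (by omega)
      rw [ws, ← mul_smul, hcm, mul_smul, ih j (by omega) (by omega) m hm2 hmp (by omega),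
        smul_zero]
    rcases i with _ | j
    · rw [w0]
      by_cases h : m = p + 1
      · simp [hg, h, hβv]
      · rw [gf m (by omega)]
        exact hfv m hm2 (by omega)
    by_cases h1 : m = j + 1
    · obtain ⟨l, rfl⟩ : ∃ l, j = l + 1 := ⟨j - 1, by omega⟩
      have h0 := ih l (by omega) (by omega) m hm2 hmp (by omega)
      subst h1
      rw [gf _ hi] at h0 ⊢
      rw [ws, ws]
      exact serre_aux1 _ _ _ _
        (hserre (l + 1 + 1) (l + 1) (by omega) hi (by omega) (by omega) (by omega)) h0
    by_cases h2 : m = j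
    · obtain ⟨l, rfl⟩ : ∃ l, j = l + 1 := ⟨j - 1, by omega⟩
      subst h2
      have h0 := ih l (by omega) (by omega) (l + 1 + 1) (by omega) (by omega) (by omega)
      have h3 := ih (l + 1) (by omega) (by omega) (l + 1) (by omega) (by omega) (by omega)
      rw [gf _ hi] at h0
      rw [gf _ (by omega), ws] at h3
      rw [gf _ (by omega), ws, ws]
      exact serre_aux2 _ hc _ _ _
        (hserre (l + 1) (l + 1 + 1) (by omega) (by omega) (by omega) hi (by omega)) h0 h3
    exact comm j rfl (by omega)
  intro i m _ hi hm2 hmp hmi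
  rw [mul_smul]
  exact key i hi m hm2 hmp hmi
end

section
/- Let k be a field and q ∈ k a nonzero scalar with q⁴ ≠ 1. Let A be an associative k-algebra containing elements f_1, …, f_p, f_β (p ≥ 1) satisfying the q-Serre relations of the negative Chevalley generators of U_q(sp(2p+2)), let M be a left A-module and v ∈ M a vector with f_a v = 0 for a = 2,…,p and f_β v = 0. Then every vector of the form g·v, where g is a finite product (word) of the generators in which f_1 occurs exactly once, f_β occurs exactly once, and each of f_2,…,f_p occurs exactly twice, is a scalar multiple of the vector f_2 f_3 ⋯ f_p · f_β · f_p f_{p−1} ⋯ f_2 f_1 · v. -/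
def chX {A M : Type*} [Ring A] [AddCommGroup M] [Module A M] (f : ℕ → A) (v : M) : ℕ → M
  | 0 => v
  | n + 1 => f (n + 1) • chX f v n

def chY {A M : Type*} [Ring A] [AddCommGroup M] [Module A M] (p : ℕ) (f : ℕ → A) (u : M) : ℕ → M
  | 0 => u
  | n + 1 => f (p - n) • chY p f u n

theorem chX_list {A M : Type*} [Ring A] [AddCommGroup M] [Module A M] (f : ℕ → A) (v : M) (n : ℕ) :
    (((List.range' 2 n).reverse.map f).prod * f 1) • v = chX f v (n + 1) := by
  induction n with
  | zero => simp [chX]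
  | succ n ih =>
    rw [chX, ← ih, List.range'_1_concat, List.reverse_append, List.map_append, List.prod_append]
    simp [mul_smul, add_comm, add_left_comm]

theorem chY_list {A M : Type*} [Ring A] [AddCommGroup M] [Module A M] (p : ℕ) (f : ℕ → A) (u : M)
    (n : ℕ) (hn : n ≤ p) :
    ((List.range' (p - n + 1) n).map f).prod • u = chY p f u n := by
  induction n with
  | zero => simp [chY]
  | succ n ih =>
    have e : p - (n + 1) + 1 = p - n := by omega
    rw [chY, ← ih (by omega), List.range'_succ, e]
    simp [mul_smul]

/-- any vector `g·v`, where `g` is a word containing `f_1` once, `f_β` once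
and each of `f_2,…,f_p` twice, is proportional to
`f_2 f_3 ⋯ f_p · f_β · f_p f_{p−1} ⋯ f_2 f_1 · v`.  (Letters are encoded by
`1,…,p,p+1` with `p+1` standing for `β`.) -/
theorem weight_space_one_dimensional
    {k A M : Type*} [Field k] [Ring A] [Algebra k A]
    [AddCommGroup M] [Module A M] [Module k M] [IsScalarTower k A M]
    (q : k) (hq0 : q ≠ 0) (hq4 : q ^ 4 ≠ 1)
    (p : ℕ) (hp : 1 ≤ p) (f : ℕ → A) (fβ : A)
    (hcomm : ∀ a b, 1 ≤ a → a ≤ p → 1 ≤ b → b ≤ p → (a + 2 ≤ b ∨ b + 2 ≤ a) →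
      f a * f b = f b * f a)
    (hβcomm : ∀ a, 1 ≤ a → a + 1 ≤ p → fβ * f a = f a * fβ)
    (hserre : ∀ a b, 1 ≤ a → a ≤ p → 1 ≤ b → b ≤ p → (b = a + 1 ∨ a = b + 1) →
      f a ^ 2 * f b - (q + q⁻¹) • (f a * f b * f a) + f b * f a ^ 2 = 0)
    (hββ : fβ ^ 2 * f p - (q ^ 2 + (q ^ 2)⁻¹) • (fβ * f p * fβ) + f p * fβ ^ 2 = 0)
    (hppβ : f p ^ 3 * fβ - (q ^ 2 + 1 + (q ^ 2)⁻¹) • (f p ^ 2 * fβ * f p)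
      + (q ^ 2 + 1 + (q ^ 2)⁻¹) • (f p * fβ * f p ^ 2) - fβ * f p ^ 3 = 0)
    (v : M)
    (hfv : ∀ a, 2 ≤ a → a ≤ p → f a • v = 0) (hβv : fβ • v = 0) :
    ∀ w : List ℕ,
      (∀ a ∈ w, 1 ≤ a ∧ a ≤ p + 1) →
      w.count 1 = 1 → w.count (p + 1) = 1 →
      (∀ a, 2 ≤ a → a ≤ p → w.count a = 2) →
      ∃ c : k,
        ((w.map fun a => if a = p + 1 then fβ else f a).prod) • v
          = c • ((((List.range' 2 (p - 1)).map f).prod * fβ *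
              (((List.range' 2 (p - 1)).reverse.map f).prod) * f 1) • v) := by
  have h2 : q + q⁻¹ ≠ 0 := by
    intro h
    apply hq4
    have h3 : q ^ 2 + 1 = 0 := by
      have : (q + q⁻¹) * q = q ^ 2 + 1 := by field_simp
      rw [← this, h, zero_mul]
    linear_combination (q ^ 2 - 1) * h3
  have hAk : ∀ (c : k) (a : A) (m : M), (c • a) • m = c • (a • m) := fun c a m => smul_assoc c a m
  have swap : ∀ (a b : A) (m : M), a * b = b * a → b • m = 0 → b • a • m = 0 := by
    intro a b m h hm
    rw [← mul_smul, ← h, mul_smul, hm, smul_zero]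
  have serre : ∀ a b, 1 ≤ a → a ≤ p → 1 ≤ b → b ≤ p → (b = a + 1 ∨ a = b + 1) → ∀ m : M,
      f a • f a • f b • m - (q + q⁻¹) • (f a • f b • f a • m) + f b • f a • f a • m = 0 := by
    intro a b h1 h2 h3 h4 h5 m
    have := congrArg (· • m) (hserre a b h1 h2 h3 h4 h5)
    simpa only [add_smul, sub_smul, hAk, pow_two, mul_smul, zero_smul] using this
  have hA : ∀ i a, i + 2 ≤ a → a ≤ p → f a • chX f v i = 0 := by
    intro i
    induction i with
    | zero => intro a h1 h2; exact hfv a (by omega) h2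
    | succ i ih =>
      intro a h1 h2
      exact swap _ _ _ (hcomm _ _ (by omega) (by omega) (by omega) h2 (by omega))
        (ih a (by omega) h2)
  have hAβ : ∀ i, i < p → fβ • chX f v i = 0 := by
    intro i
    induction i with
    | zero => intro _; exact hβv
    | succ i ih =>
      intro h
      exact swap _ _ _ (hβcomm _ (by omega) (by omega)).symm (ih (by omega))
  have hB : ∀ a, a + 2 ≤ p → f (a + 2) • chX f v (a + 2) = 0 := by
    intro a h
    have h0 := hA a (a + 2) le_rfl h
    have := serre (a + 2) (a + 1) (by omega) h (by omega) (by omega) (by omega) (chX f v a)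
    simpa [h0, chX] using this
  have hC : ∀ a, 2 ≤ a → ∀ n, a + 1 + n ≤ p → f a • chX f v (a + 1 + n) = 0 := by
    intro a ha n
    obtain ⟨a, rfl⟩ : ∃ b, a = b + 2 := ⟨a - 2, by omega⟩
    induction n with
    | zero =>
      intro h
      have h0 := hA (a + 1) (a + 3) le_rfl (by omega)
      have h1 := hB a (by omega)
      have := serre (a + 2) (a + 3) (by omega) (by omega) (by omega) (by omega) (by omega)
        (chX f v (a + 1))
      rw [chX] at h1
      rw [h0, h1] at this
      simp only [smul_zero, zero_sub, add_zero, neg_eq_zero] at this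
      exact (smul_eq_zero.mp this).resolve_left h2
    | succ n ih =>
      intro h
      exact swap _ _ _ (hcomm (a + 2 + 1 + n + 1) (a + 2) (by omega) (by omega) (by omega) (by omega) (by omega))
        (ih (by omega))
  have hD : ∀ d a, 2 ≤ a → a + d < p → f a • chY p f (fβ • chX f v p) d = 0 := by
    intro d
    induction d with
    | zero =>
      intro a ha h
      refine swap _ _ _ (hβcomm a (by omega) (by omega)) ?_
      have := hC a ha (p - (a + 1)) (by omega)
      rwa [show a + 1 + (p - (a + 1)) = p by omega] at this
    | succ d ih =>
      intro a ha h
      exact swap _ _ _ (hcomm _ _ (by omega) (by omega) (by omega) (by omega) (by omega))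
        (ih a ha (by omega))
  have key : ∀ w : List ℕ, (∀ a ∈ w, 1 ≤ a ∧ a ≤ p + 1) → w.count 1 ≤ 1 → w.count (p + 1) ≤ 1 →
      (∀ a, 2 ≤ a → a ≤ p → w.count a ≤ 2) →
      ((w.map fun a => if a = p + 1 then fβ else f a).prod) • v = 0 ∨
      (∃ i, i ≤ p ∧ ((w.map fun a => if a = p + 1 then fβ else f a).prod) • v = chX f v i ∧
        w.count (p + 1) = 0 ∧ ∀ a, 1 ≤ a → a ≤ p → w.count a = if a ≤ i then 1 else 0) ∨
      (∃ d, d + 1 ≤ p ∧ ((w.map fun a => if a = p + 1 then fβ else f a).prod) • v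
          = chY p f (fβ • chX f v p) d ∧
        w.count (p + 1) = 1 ∧ ∀ a, 1 ≤ a → a ≤ p → w.count a = if a + d ≤ p then 1 else 2) := by
    intro w
    induction w with
    | nil =>
      intro _ _ _ _
      refine Or.inr (Or.inl ⟨0, by omega, by simp [chX], by simp, ?_⟩)
      intro a h1 h2
      rw [if_neg (by omega)]; simp
    | cons b w ih =>
      intro hw c1 cp c2
      have hb := hw b (by simp)
      simp only [List.count_cons, beq_iff_eq] at c1 cp c2 ⊢
      rw [List.map_cons, List.prod_cons, mul_smul]
      rcases ih (fun a ha => hw a (by simp [ha])) (by omega) (by omega)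
        (fun a h1 h2 => by have := c2 a h1 h2; omega) with h | ⟨i, hi, h, hp0, hc⟩ | ⟨d, hd, h, hp1, hc⟩
      · left; rw [h, smul_zero]
      · rw [h]
        by_cases hbp : b = p + 1
        · rw [if_pos hbp]
          by_cases hip : i = p
          · subst hip
            refine Or.inr (Or.inr ⟨0, by omega, rfl, by simp [hbp, hp0], ?_⟩)
            intro a h1 h2
            rw [hc a h1 h2]
            split_ifs <;> omega
          · left; exact hAβ i (by omega)
        · rw [if_neg hbp]
          by_cases hbi : b = i + 1
          · refine Or.inr (Or.inl ⟨i + 1, by omega, by rw [hbi]; rfl, by simp [hbp, hp0], ?_⟩)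
            intro a h1 h2
            rw [hc a h1 h2]
            split_ifs <;> omega
          · left
            by_cases hb1 : b = 1
            · exfalso
              have := hc 1 le_rfl hp
              rw [if_pos (by omega)] at this
              rw [if_pos hb1] at c1
              omega
            rcases lt_trichotomy b i with hlt | heq | hgt
            · have := hC b (by omega) (i - (b + 1)) (by omega)
              rwa [show b + 1 + (i - (b + 1)) = i by omega] at this
            · subst heq
              have := hB (b - 2) (by omega)
              rwa [show b - 2 + 2 = b by omega] at this
            · exact hA i b (by omega) (by omega)
      · rw [h]
        by_cases hbp : b = p + 1
        · exfalso; rw [if_pos hbp] at cp; omega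
        rw [if_neg hbp]
        by_cases hb1 : b = 1
        · exfalso
          have := hc 1 le_rfl hp
          rw [if_pos (by omega)] at this
          rw [if_pos hb1] at c1
          omega
        rcases lt_trichotomy (b + d) p with hlt | heq | hgt
        · left; exact hD d b (by omega) hlt
        · refine Or.inr (Or.inr ⟨d + 1, by omega, ?_, by simp [hbp, hp1], ?_⟩)
          · rw [chY, show p - d = b by omega]
          · intro a h1 h2
            rw [hc a h1 h2]
            split_ifs <;> omega
        · exfalso
          have := c2 b (by omega) (by omega)
          rw [hc b (by omega) (by omega), if_neg (by omega), if_pos rfl] at this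
          omega
  intro w hw c1 cp c2
  rcases key w hw c1.le cp.le (fun a h1 h2 => (c2 a h1 h2).le) with
    h | ⟨i, hi, h, hp0, hc⟩ | ⟨d, hd, h, hp1, hc⟩
  · exact ⟨0, by rw [h, zero_smul]⟩
  · omega
  · refine ⟨1, ?_⟩
    have hdp : d = p - 1 := by
      by_contra hne
      have := hc 2 (by omega) (by omega)
      rw [c2 2 le_rfl (by omega), if_pos (by omega)] at this
      omega
    rw [one_smul, h, mul_assoc, mul_smul, chX_list, mul_smul, show p - 1 + 1 = p by omega, hdp,
      ← chY_list p f _ (p - 1) (by omega), show p - (p - 1) + 1 = 2 by omega]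
end

section
/- Let k be a field and q ∈ k a nonzero scalar with q⁴ ≠ 1. Let A be an associative k-algebra containing elements f_1, …, f_p, f_β (p ≥ 1) satisfying the q-Serre relations of the negative Chevalley generators of U_q(sp(2p+2)). Set f_γ := [f_1,[f_2,…,[f_{p−1},f_p]_q…]_q]_q and f̃_γ := [f_1,[f_2,…,[f_{p−1},f_p]_{q⁻¹}…]_{q⁻¹}]_{q⁻¹}, where [u,v]_t := uv − t·vu, and define f_δ := [f_γ, [f̃_γ, f_β]_{q⁻²}]_{q²}. Then: (a) f_δ = [f̃_γ, [f_γ, f_β]_{q²}]_{q⁻²}; and (b) f_δ = [f_1, [f_2, …, [f_p, X]_{q⁻¹} …]_{q⁻¹}]_{q⁻²}, where X := [f_1, [f_2, …, [f_{p−1}, [f_p, f_β]_{q²}]_q …]_q]_q; explicitly, f_δ is obtained from f_β by first applying the q²-commutator with f_p, then q-commutators with f_{p−1}, f_{p−2}, …, f_1 (in this order), then q⁻¹-commutators with f_p, f_{p−1}, …, f_2, and finally the q⁻²-commutator with f_1. -/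
section helpers
variable {k A : Type*} [Field k] [Ring A] [Algebra k A]

/-- `x y = s y x`. -/
def QC (s : k) (x y : A) : Prop := x * y = s • (y * x)

theorem QC.left {s s' : k} {a b u : A} (t : k) (h : QC s a u) (h' : QC s' b u) :
    QC (s * s') (qComm t a b) u := by
  unfold QC at *
  have h1 : a * b * u = (s * s') • (u * (a * b)) := by
    rw [mul_assoc, h', mul_smul_comm, ← mul_assoc, h, smul_mul_assoc, smul_smul, mul_assoc,
      mul_comm s]
  have h2 : b * a * u = (s * s') • (u * (b * a)) := by
    rw [mul_assoc, h, mul_smul_comm, ← mul_assoc, h', smul_mul_assoc, smul_smul, mul_assoc]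
  simp only [qComm, sub_mul, mul_sub, smul_mul_assoc, mul_smul_comm, h1, h2]
  module

theorem QC.right {s s' : k} {a b u : A} (t : k) (h : QC s u a) (h' : QC s' u b) :
    QC (s * s') u (qComm t a b) := by
  unfold QC at *
  have h1 : u * (a * b) = (s * s') • (a * b * u) := by
    rw [← mul_assoc, h, smul_mul_assoc, mul_assoc, h', mul_smul_comm, smul_smul, mul_assoc]
  have h2 : u * (b * a) = (s * s') • (b * a * u) := by
    rw [← mul_assoc, h', smul_mul_assoc, mul_assoc, h, mul_smul_comm, smul_smul, mul_assoc,
      mul_comm s']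
  simp only [qComm, sub_mul, mul_sub, smul_mul_assoc, mul_smul_comm, h1, h2]
  module

theorem QC.one {x y : A} (h : x * y = y * x) : QC (1 : k) x y := by
  unfold QC; rw [one_smul, h]

theorem QC.comm {x y : A} (h : QC (1 : k) x y) : x * y = y * x := by
  unfold QC at h; rwa [one_smul] at h

theorem qComm_one_right {a x y : A} (t : k) (hx : a * x = x * a) (hy : a * y = y * a) :
    a * qComm t x y = qComm t x y * a := by
  have := QC.right (k := k) t (QC.one hx) (QC.one hy)
  rw [one_mul] at this
  exact this.comm

/-- associativity, `a` commutes with `b`. -/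
theorem qComm_assoc1 {a w b : A} (s t : k) (h : a * b = b * a) :
    qComm t a (qComm s w b) = qComm s (qComm t a w) b := by
  simp only [qComm, sub_mul, mul_sub, smul_mul_assoc, mul_smul_comm, smul_sub]
  have h1 : a * (b * w) = b * (a * w) := by rw [← mul_assoc, h, mul_assoc]
  have h2 : w * b * a = w * a * b := by rw [mul_assoc, ← h, mul_assoc]
  rw [h1, h2]
  simp only [mul_assoc]
  module

theorem qComm_assoc2 {f w X : A} (q : k) (hq : q ≠ 0) (h : QC q⁻¹ f X) :
    qComm ((q ^ 2)⁻¹) f (qComm q⁻¹ w X) = qComm ((q ^ 2)⁻¹) (qComm q⁻¹ f w) X := by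
  simp only [qComm, sub_mul, mul_sub, smul_mul_assoc, mul_smul_comm, smul_sub]
  unfold QC at h
  have h1 : f * (X * w) = q⁻¹ • (X * f * w) := by rw [← mul_assoc, h, smul_mul_assoc]
  have h2 : w * f * X = q⁻¹ • (w * X * f) := by rw [mul_assoc, h, mul_smul_comm, mul_assoc]
  rw [h1, h2]
  simp only [mul_assoc]
  match_scalars <;> field_simp <;> ring

/-- q-Serre relation. -/
def SerreZ (c : k) (x W : A) : Prop := x ^ 2 * W - c • (x * W * x) + W * x ^ 2 = 0

theorem SerreZ.qComm {c t : k} {x y w : A} (h : SerreZ c x y) (hc : x * w = w * x) :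
    SerreZ c x (qComm t y w) := by
  unfold SerreZ at *
  have e : x ^ 2 * w = w * x ^ 2 := by rw [pow_two, mul_assoc, hc, ← mul_assoc, hc, mul_assoc]
  have e1 : x ^ 2 * (w * y) = w * (x ^ 2 * y) := by rw [← mul_assoc, e, mul_assoc]
  have e2 : y * (w * x ^ 2) = y * (x ^ 2 * w) := by rw [e]
  have e3 : x * (w * (y * x)) = w * (x * (y * x)) := by rw [← mul_assoc, hc, mul_assoc]
  have e4 : x * (y * (w * x)) = x * (y * (x * w)) := by rw [hc]
  have h1 := congrArg (· * w) h
  have h2 := congrArg (w * ·) h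
  simp only [_root_.qComm, mul_assoc, add_mul, mul_add, mul_zero, zero_mul, sub_mul, mul_sub, smul_mul_assoc,
    mul_smul_comm, smul_sub, e1, e2, e3, e4] at *
  linear_combination (norm := module) h1 - t • h2

theorem SerreZ.quasi {q : k} (hq : q ≠ 0) {x w : A} (h : SerreZ (q + q⁻¹) x w) :
    QC q⁻¹ x (_root_.qComm q x w) := by
  unfold SerreZ at h
  unfold QC
  simp only [_root_.qComm, mul_assoc, sub_mul, mul_sub, smul_mul_assoc,
    mul_smul_comm, smul_sub, pow_two, smul_smul, inv_mul_cancel₀ hq] at *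
  linear_combination (norm := module) h

theorem SerreZ.quasi' {q : k} (hq : q ≠ 0) {x w : A} (h : SerreZ (q + q⁻¹) x w) :
    QC q x (_root_.qComm q w x) := by
  unfold SerreZ at h
  unfold QC
  simp only [_root_.qComm, mul_assoc, sub_mul, mul_sub, smul_mul_assoc,
    mul_smul_comm, smul_sub, pow_two, smul_smul] at *
  have h1 := congrArg ((-q) • ·) h
  simp only [smul_add, smul_sub, smul_zero, smul_smul] at h1
  rw [← sub_eq_zero]
  rw [← h1]
  match_scalars <;> field_simp <;> ring

theorem middle {q : k} (hq : q ≠ 0) (hc : q + q⁻¹ ≠ 0) {a b c : A}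
    (h1 : SerreZ (q + q⁻¹) b a) (h2 : SerreZ (q + q⁻¹) b c) (hac : a * c = c * a) :
    b * qComm q a (qComm q b c) = qComm q a (qComm q b c) * b := by
  unfold SerreZ at *
  have e : ∀ z, a * (c * z) = c * (a * z) := fun z => by rw [← mul_assoc, hac, mul_assoc]
  have g1 : (q + q⁻¹) • (b * (a * b)) = b * (b * a) + a * (b * b) := by
    simp only [pow_two, mul_assoc] at h1
    linear_combination (norm := module) - h1
  have g2 : (q + q⁻¹) • (b * (c * b)) = b * (b * c) + c * (b * b) := by
    simp only [pow_two, mul_assoc] at h2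
    linear_combination (norm := module) - h2
  have k1 := congrArg (· * c) g1
  have k2 := congrArg (c * ·) g1
  have k3 := congrArg (· * a) g2
  have k4 := congrArg (a * ·) g2
  apply smul_right_injective A hc
  simp only [qComm, mul_assoc, add_mul, mul_add, sub_mul, mul_sub, smul_mul_assoc,
    mul_smul_comm, smul_sub, e, hac] at *
  rw [← sub_eq_zero]
  have key := congrArg₂ (· + ·) (congrArg₂ (· - ·) k1 (congrArg (q ^ 2 • ·) k2))
    (congrArg₂ (· - ·) (congrArg (q ^ 2 • ·) k3) k4)
  rw [← sub_eq_zero] at key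
  rw [← key]
  match_scalars <;> field_simp <;> ring

theorem fold_commute (t : k) (f : ℕ → A) (x z : A) (n : ℕ) : ∀ (i : ℕ),
    (∀ a, i ≤ a → a < i + n → x * f a = f a * x) → x * z = z * x →
    x * (List.range' i n).foldr (fun a acc => qComm t (f a) acc) z =
      (List.range' i n).foldr (fun a acc => qComm t (f a) acc) z * x := by
  induction n with
  | zero => intro i _ h; simpa using h
  | succ n ih =>
    intro i h hz
    rw [List.range'_succ, List.foldr_cons]
    exact qComm_one_right t (h i le_rfl (by omega))
      (ih (i + 1) (fun a h1 h2 => h a (by omega) (by omega)) hz)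

theorem fold_assoc (s t : k) (f : ℕ → A) (z b : A) (n : ℕ) : ∀ (i : ℕ),
    (∀ a, i ≤ a → a < i + n → f a * b = b * f a) →
    (List.range' i n).foldr (fun a acc => qComm t (f a) acc) (qComm s z b) =
      qComm s ((List.range' i n).foldr (fun a acc => qComm t (f a) acc) z) b := by
  induction n with
  | zero => intro i _; simp
  | succ n ih =>
    intro i h
    rw [List.range'_succ, List.foldr_cons, List.foldr_cons,
      ih (i + 1) (fun a h1 h2 => h a (by omega) (by omega))]
    exact qComm_assoc1 s t (h i le_rfl (by omega))

/-- iterated commutator with right end index `i + n`. -/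
def G (t : k) (f : ℕ → A) (i n : ℕ) : A :=
  (List.range' i n).foldr (fun a acc => qComm t (f a) acc) (f (i + n))

theorem G_zero (t : k) (f : ℕ → A) (i : ℕ) : G t f i 0 = f i := by simp [G]

theorem G_succ (t : k) (f : ℕ → A) (i n : ℕ) :
    G t f i (n + 1) = qComm t (f i) (G t f (i + 1) n) := by
  simp only [G, List.range'_succ, List.foldr_cons]
  rw [show i + (n + 1) = i + 1 + n by omega]

theorem G_commute (t : k) (f : ℕ → A) (x : A) (i n : ℕ)
    (h : ∀ a, i ≤ a → a ≤ i + n → x * f a = f a * x) : x * G t f i n = G t f i n * x :=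
  fold_commute t f x _ n i (fun a h1 h2 => h a h1 (by omega)) (h _ (by omega) le_rfl)

/-- type A relations for indices in `[1,p]`. -/
structure TA (q : k) (p : ℕ) (f : ℕ → A) : Prop where
  cm : ∀ a b, 1 ≤ a → a ≤ p → 1 ≤ b → b ≤ p → (a + 2 ≤ b ∨ b + 2 ≤ a) → f a * f b = f b * f a
  se : ∀ a b, 1 ≤ a → a ≤ p → 1 ≤ b → b ≤ p → (b = a + 1 ∨ a = b + 1) →
      SerreZ (q + q⁻¹) (f a) (f b)

variable {q : k} {p : ℕ} {f : ℕ → A}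

theorem TA.serreG (T : TA q p f) (t : k) (i n : ℕ) (hi : 1 ≤ i) (hn : i + 1 + n ≤ p) :
    SerreZ (q + q⁻¹) (f i) (G t f (i + 1) n) := by
  cases n with
  | zero => rw [G_zero]; exact T.se _ _ hi (by omega) (by omega) (by omega) (by omega)
  | succ n =>
    rw [G_succ]
    refine SerreZ.qComm (T.se _ _ hi (by omega) (by omega) (by omega) (by omega)) ?_
    exact G_commute _ _ _ _ _ fun a h1 h2 =>
      T.cm _ _ hi (by omega) (by omega) (by omega) (by omega)

theorem TA.first (T : TA q p f) (hq : q ≠ 0) (i n : ℕ) (hi : 1 ≤ i) (hn : i + 1 + n ≤ p) :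
    QC q⁻¹ (f i) (G q f i (n + 1)) := by
  rw [G_succ]; exact (T.serreG q i n hi hn).quasi hq

theorem TA.last (T : TA q p f) (hq : q ≠ 0) (n : ℕ) : ∀ i, 1 ≤ i → i + 1 + n = p →
    QC q (f p) (G q f i (n + 1)) := by
  induction n with
  | zero =>
    intro i hi hn
    rw [G_succ, G_zero, show i + 1 = p by omega]
    exact (T.se _ _ (by omega) (by omega) (by omega) (by omega) (by omega)).quasi' hq
  | succ n ih =>
    intro i hi hn
    rw [G_succ]
    have := QC.right q (QC.one (k := k) (T.cm p i (by omega) (by omega) hi (by omega) (by omega)))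
      (ih (i + 1) (by omega) (by omega))
    rwa [one_mul] at this

theorem TA.mid (T : TA q p f) (hq : q ≠ 0) (hc : q + q⁻¹ ≠ 0) (n : ℕ) : ∀ i j, 1 ≤ i → i < j →
    j < i + n → i + n ≤ p → f j * G q f i n = G q f i n * f j := by
  induction n with
  | zero => intro i j _ _ _ _; omega
  | succ n ih =>
    intro i j hi hij hj hn
    by_cases h : j = i + 1
    · subst h
      obtain ⟨m, rfl⟩ : ∃ m, n = m + 1 := ⟨n - 1, by omega⟩
      rw [G_succ, G_succ]
      refine middle hq hc (T.se _ _ (by omega) (by omega) (by omega) (by omega) (by omega))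
        (T.serreG q _ _ (by omega) (by omega)) ?_
      exact G_commute _ _ _ _ _ fun a h1 h2 =>
        T.cm _ _ hi (by omega) (by omega) (by omega) (by omega)
    · rw [G_succ]
      exact qComm_one_right q (T.cm _ _ (by omega) (by omega) hi (by omega) (by omega))
        (ih (i + 1) j (by omega) (by omega) (by omega) (by omega))

theorem QC_G (t s : k) (u : A) (n : ℕ) : ∀ i,
    (∀ a, i ≤ a → a < i + n → f a * u = u * f a) → QC s (f (i + n)) u →
    QC s (G t f i n) u := by
  induction n with
  | zero => intro i _ h; rw [G_zero]; exact h
  | succ n ih =>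
    intro i h hz
    rw [G_succ]
    have := QC.left t (QC.one (k := k) (h i le_rfl (by omega)))
      (ih (i + 1) (fun a h1 h2 => h a (by omega) (by omega))
        (by rw [show i + 1 + n = i + (n + 1) by omega]; exact hz))
    rwa [one_mul] at this

theorem TA.UV (T : TA q p f) (hq : q ≠ 0) (hc : q + q⁻¹ ≠ 0) (t : k) (n : ℕ) (hn : n + 1 = p) :
    G q f 1 n * G t f 1 n = G t f 1 n * G q f 1 n := by
  cases n with
  | zero => simp [G_zero]
  | succ n =>
    have h2 : QC q (G t f (1 + 1) n) (G q f 1 (n + 1)) := by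
      refine QC_G t q _ n _ (fun a h1 h2 => ?_) ?_
      · exact T.mid hq hc _ _ _ le_rfl (by omega) (by omega) (by omega)
      · rw [show 1 + 1 + n = p by omega]
        exact T.last hq n 1 le_rfl (by omega)
    have h := QC.left t (T.first hq 1 n le_rfl (by omega)) h2
    rw [inv_mul_cancel₀ hq, ← G_succ] at h
    exact h.comm.symm

theorem swap {u v b : A} (s t : k) (h : u * v = v * u) :
    qComm t u (qComm s v b) = qComm s v (qComm t u b) := by
  simp only [qComm, sub_mul, mul_sub, smul_mul_assoc, mul_smul_comm, smul_sub]
  have h1 : u * (v * b) = v * (u * b) := by rw [← mul_assoc, h, mul_assoc]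
  rw [h1]
  simp only [mul_assoc, h]
  module

end helpers

theorem f_delta_rearrangement
    {k A : Type*} [Field k] [Ring A] [Algebra k A]
    (q : k) (hq0 : q ≠ 0) (hq4 : q ^ 4 ≠ 1)
    (p : ℕ) (hp : 1 ≤ p) (f : ℕ → A) (fβ : A)
    (hcomm : ∀ a b, 1 ≤ a → a ≤ p → 1 ≤ b → b ≤ p → (a + 2 ≤ b ∨ b + 2 ≤ a) →
      f a * f b = f b * f a)
    (hβcomm : ∀ a, 1 ≤ a → a + 1 ≤ p → fβ * f a = f a * fβ)
    (hserre : ∀ a b, 1 ≤ a → a ≤ p → 1 ≤ b → b ≤ p → (b = a + 1 ∨ a = b + 1) →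
      f a ^ 2 * f b - (q + q⁻¹) • (f a * f b * f a) + f b * f a ^ 2 = 0)
    (hββ : fβ ^ 2 * f p - (q ^ 2 + (q ^ 2)⁻¹) • (fβ * f p * fβ) + f p * fβ ^ 2 = 0)
    (hppβ : f p ^ 3 * fβ - (q ^ 2 + 1 + (q ^ 2)⁻¹) • (f p ^ 2 * fβ * f p)
      + (q ^ 2 + 1 + (q ^ 2)⁻¹) • (f p * fβ * f p ^ 2) - fβ * f p ^ 3 = 0) :
    qComm (q ^ 2) (iterQComm q f 1 p) (qComm ((q ^ 2)⁻¹) (iterQComm q⁻¹ f 1 p) fβ)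
      = qComm ((q ^ 2)⁻¹) (iterQComm q⁻¹ f 1 p)
          (qComm (q ^ 2) (iterQComm q f 1 p) fβ) ∧
    qComm (q ^ 2) (iterQComm q f 1 p) (qComm ((q ^ 2)⁻¹) (iterQComm q⁻¹ f 1 p) fβ)
      = qComm ((q ^ 2)⁻¹) (f 1)
          ((List.range' 2 (p - 1)).foldr (fun a acc => qComm q⁻¹ (f a) acc)
            ((List.range' 1 (p - 1)).foldr (fun a acc => qComm q (f a) acc)
              (qComm (q ^ 2) (f p) fβ))) := by
  obtain ⟨n, rfl⟩ : ∃ n, p = n + 1 := ⟨p - 1, by omega⟩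
  have hc : q + q⁻¹ ≠ 0 := by
    intro h
    apply hq4
    have h2 : q ^ 2 + 1 = 0 := by
      have := congrArg (q * ·) h
      simp only [mul_add, mul_inv_cancel₀ hq0, mul_zero] at this
      rw [pow_two]; exact this
    linear_combination (q ^ 2 - 1) * h2
  have T : TA q (n + 1) f := ⟨hcomm, hserre⟩
  have hG : ∀ t : k, iterQComm t f 1 (n + 1) = G t f 1 n := by
    intro t
    simp only [iterQComm, G, Nat.add_sub_cancel, Nat.add_comm 1 n]
  rw [hG, hG]
  have hsw := swap (b := fβ) ((q ^ 2)⁻¹) (q ^ 2) (T.UV hq0 hc q⁻¹ n rfl)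
  refine ⟨hsw, hsw.trans ?_⟩
  rw [Nat.add_sub_cancel, fold_assoc _ _ _ _ _ _ _
    (fun a h1 h2 => (hβcomm a h1 (by omega)).symm)]
  have hG1 : (List.range' 1 n).foldr (fun a acc => qComm q (f a) acc) (f (n + 1)) = G q f 1 n := by
    simp only [G, Nat.add_comm 1 n]
  rw [hG1]
  cases n with
  | zero => simp [G_zero]
  | succ m =>
    set X := qComm (q ^ 2) (G q f 1 (m + 1)) fβ with hX
    have hX1 : QC q⁻¹ (f 1) X := by
      have := QC.right (q ^ 2) (T.first hq0 1 m le_rfl (by omega))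
        (QC.one (k := k) (hβcomm 1 le_rfl (by omega)).symm)
      rwa [mul_one] at this
    have hXm : ∀ a, 2 ≤ a → a < 2 + m → f a * X = X * f a := fun a h1 h2 =>
      qComm_one_right _ (T.mid hq0 hc _ _ _ le_rfl (by omega) (by omega) (by omega))
        (hβcomm a (by omega) (by omega)).symm
    have hr : (List.range' 2 (m + 1)).foldr (fun a acc => qComm q⁻¹ (f a) acc) X
        = qComm q⁻¹ (G q⁻¹ f 2 m) X := by
      rw [List.range'_concat, List.foldr_append, one_mul]
      exact fold_assoc _ _ _ _ _ _ _ hXm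
    rw [hr, qComm_assoc2 q hq0 hX1, G_succ]
end
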